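/- arXiv:1607.05675 — 10 statements merged into one kernel-verified Lean document; each statement's English description precedes it below -/
import Mathlib

section
/- For positive integers n and k, the inequality k ≤ ⌊n + 1 − log₂(n + 1 − log₂ n)⌋ holds if and only if 2^{n+1−k} ≥ k (where 2^{n+1−k} is interpreted as a real number, so that negative exponents are allowed). -/
theorem logb_two_natCast_lt_of_lt_two_pow {n j : ℕ} (hn : 0 < n) (h : n < 2 ^ j) :
    Real.logb 2 (n : ℝ) < j := by
  rw [Real.logb_lt_iff_lt_rpow one_lt_two (by exact_mod_cast hn), Real.rpow_natCast]
  exact_mod_cast h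

/-- Replacing `m` by `log₂ n` does not change whether `n + 1 - m ≤ 2 ^ m`. -/
theorem add_one_sub_logb_le_two_pow_iff {n : ℕ} (m : ℕ) (hn : 0 < n) :
    (n : ℝ) + 1 - Real.logb 2 n ≤ 2 ^ m ↔ (n : ℝ) + 1 - m ≤ 2 ^ m := by
  have hlog : 0 ≤ Real.logb 2 (n : ℝ) :=
    Real.logb_nonneg one_lt_two (by exact_mod_cast hn)
  constructor
  · intro h
    by_contra! hlt
    have hlt' : 2 ^ m + m < n + 1 := by
      have : (2 : ℝ) ^ m + m < n + 1 := by linarith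
      exact_mod_cast this
    obtain ⟨j, rfl⟩ := Nat.exists_eq_add_of_le (show 2 ^ m ≤ n by omega)
    have hpow : 2 ^ m ≤ 2 ^ j := Nat.pow_le_pow_right two_pos (by omega)
    have hj : j < 2 ^ j := Nat.lt_two_pow_self
    have hlog_lt := logb_two_natCast_lt_of_lt_two_pow hn
      (show 2 ^ m + j < 2 ^ (j + 1) by rw [pow_succ]; omega)
    push_cast at h hlog_lt
    linarith
  · intro h
    rcases lt_or_ge n (2 ^ m) with hlt | hge
    · have : (n : ℝ) + 1 ≤ 2 ^ m := by exact_mod_cast hlt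
      linarith
    · have : (m : ℝ) ≤ Real.logb 2 n := by
        rw [Real.le_logb_iff_rpow_le one_lt_two (by exact_mod_cast hn), Real.rpow_natCast]
        exact_mod_cast hge
      linarith

/-- For positive integers `n` and `k`,
`k ≤ ⌊n + 1 − log₂(n + 1 − log₂ n)⌋` if and only if `2^(n+1−k) ≥ k`,
where the power is a real power so that negative exponents are allowed. -/
theorem stmt0 (n k : ℕ) (hn : 0 < n) (hk : 0 < k) :
    (k : ℤ) ≤ ⌊(n : ℝ) + 1 - Real.logb 2 ((n : ℝ) + 1 - Real.logb 2 n)⌋ ↔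
      (k : ℝ) ≤ (2 : ℝ) ^ ((n : ℝ) + 1 - (k : ℝ)) := by
  have hlog : Real.logb 2 (n : ℝ) < n :=
    logb_two_natCast_lt_of_lt_two_pow hn Nat.lt_two_pow_self
  rw [Int.le_floor, Int.cast_natCast, le_sub_comm,
    Real.logb_le_iff_le_rpow one_lt_two (by linarith)]
  rcases le_or_gt k (n + 1) with hkn | hkn
  · obtain ⟨m, hm⟩ := Nat.exists_eq_add_of_le hkn
    have hm' : (n : ℝ) + 1 = k + m := by exact_mod_cast hm
    have hexp : (n : ℝ) + 1 - k = m := by linarith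
    have hbase : (n : ℝ) + 1 - m = k := by linarith
    rw [hexp, Real.rpow_natCast, add_one_sub_logb_le_two_pow_iff m hn, hbase]
  · have hkn' : (n : ℝ) + 1 < k := by exact_mod_cast hkn
    have hpow : (2 : ℝ) ^ ((n : ℝ) + 1 - k) < 1 :=
      Real.rpow_lt_one_of_one_lt_of_neg one_lt_two (by linarith)
    have hk' : (1 : ℝ) ≤ k := by exact_mod_cast hk
    constructor <;> intro h <;> linarith
end

section
/- Let G be a finite abelian group (written additively) and H a subgroup of G. Suppose A is the union of sets A₁, …, A_k where each Aᵢ is contained in a coset gᵢ + H of H and the cosets g₁ + H, …, g_k + H are pairwise distinct; similarly suppose B is the union of sets B₁, …, B_k where each Bᵢ is contained in a coset g′ᵢ + H and the cosets g′₁ + H, …, g′_k + H are pairwise distinct. If for each 1 ≤ i ≤ k the sets A ∖ Aᵢ and B ∖ Bᵢ are translates of one another, then A and B are (k−1)-indistinguishable. -/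
open Finset

/-- The `k`-deck of a multiset `φ : G → ℕ`:
`deck k φ (s₁,…,s_k) = ∑_{g ∈ G} φ(g+s₁)⋯φ(g+s_k)`. -/
def deck {G : Type*} [Fintype G] [AddCommGroup G] (k : ℕ) (φ : G → ℕ) :
    (Fin k → G) → ℕ :=
  fun s => ∑ g : G, ∏ i, φ (g + s i)

/-- `φ` and `ψ` are `k`-indistinguishable if their `i`-decks agree for all `i ≤ k`. -/
def Indist {G : Type*} [Fintype G] [AddCommGroup G] (k : ℕ) (φ ψ : G → ℕ) : Prop :=
  ∀ i, i ≤ k → deck i φ = deck i ψ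

/-- The indicator function of a finite subset, identifying subsets with multisets. -/
def indic {G : Type*} [DecidableEq G] (A : Finset G) : G → ℕ :=
  fun x => if x ∈ A then 1 else 0

theorem prod_indic {G ι : Type*} [DecidableEq G] [Fintype ι] (A : Finset G) (f : ι → G) :
    ∏ j, indic A (f j) = if ∀ j, f j ∈ A then 1 else 0 := by
  simp [indic, Finset.prod_ite_zero]

/-- The deck of a finite set is invariant under translation. -/
theorem deck_indic_image_add {G : Type*} [Fintype G] [AddCommGroup G] [DecidableEq G]
    (m : ℕ) (A : Finset G) (z : G) :
    deck m (indic (A.image (fun x => z + x))) = deck m (indic A) := by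
  have h : ∀ x, indic (A.image (fun x => z + x)) (z + x) = indic A x := by
    simp [indic]
  funext s
  unfold deck
  rw [← Equiv.sum_comp (Equiv.addLeft z)]
  simp only [Equiv.coe_addLeft, add_assoc, h]

/-- A translate of `s` lying in a union of pieces from distinct cosets of `H` meets exactly as
many pieces as `s` meets cosets of `H`. -/
theorem card_filter_exists_mem {G ι κ : Type*} [AddCommGroup G] [DecidableEq G]
    [Fintype ι] [Fintype κ] (H : AddSubgroup G) [DecidableEq (G ⧸ H)]
    (As : κ → Finset G) (g : κ → G)
    (hcoset : ∀ l, ∀ x ∈ As l, x - g l ∈ H)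
    (hdistinct : ∀ i j, i ≠ j → g i - g j ∉ H)
    (s : ι → G) (x : G) (hx : ∀ j, ∃ l, x + s j ∈ As l) :
    #{l | ∃ j, x + s j ∈ As l} = #(univ.image fun j => (s j : G ⧸ H)) := by
  have key : ∀ l y, y ∈ As l → (y : G ⧸ H) = g l := fun l y hy => by
    rw [QuotientAddGroup.eq_iff_sub_mem]
    exact hcoset l y hy
  refine Finset.card_bij (fun l _ => (g l : G ⧸ H) - x) ?_ ?_ ?_
  · intro l hl
    obtain ⟨j, hj⟩ := (Finset.mem_filter.1 hl).2
    refine Finset.mem_image.2 ⟨j, Finset.mem_univ _, ?_⟩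
    rw [← key l _ hj, QuotientAddGroup.mk_add, add_sub_cancel_left]
  · intro l _ l' _ h
    by_contra hne
    exact hdistinct l l' hne (QuotientAddGroup.eq_iff_sub_mem.1 (sub_left_injective h))
  · intro q hq
    obtain ⟨j, -, rfl⟩ := Finset.mem_image.1 hq
    obtain ⟨l, hl⟩ := hx j
    refine ⟨l, Finset.mem_filter.2 ⟨Finset.mem_univ _, j, hl⟩, ?_⟩
    rw [← key l _ hl, QuotientAddGroup.mk_add, add_sub_cancel_left]

/-- Summing the decks of the sets obtained by deleting one piece counts each occurrence of `s`
once for every piece it misses. -/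
theorem sum_deck_indic_sdiff {G : Type*} [Fintype G] [AddCommGroup G] [DecidableEq G]
    {k : ℕ} (H : AddSubgroup G) [DecidableEq (G ⧸ H)] (As : Fin k → Finset G) (g : Fin k → G)
    (hcoset : ∀ l, ∀ x ∈ As l, x - g l ∈ H)
    (hdistinct : ∀ i j, i ≠ j → g i - g j ∉ H) (m : ℕ) (s : Fin m → G) :
    ∑ l, deck m (indic (univ.biUnion As \ As l)) s =
      (k - #(univ.image fun j => (s j : G ⧸ H))) * deck m (indic (univ.biUnion As)) s := by
  simp only [deck, prod_indic]
  rw [Finset.sum_comm, Finset.mul_sum]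
  refine Finset.sum_congr rfl fun x _ => ?_
  by_cases hx : ∀ j, x + s j ∈ univ.biUnion As
  · have hx' : ∀ j, ∃ l, x + s j ∈ As l := by simpa using hx
    rw [← card_filter_exists_mem H As g hcoset hdistinct s x hx', if_pos hx, mul_one]
    have h := Finset.card_filter_add_card_filter_not (s := (univ : Finset (Fin k)))
      (fun l => ∃ j, x + s j ∈ As l)
    rw [Finset.card_univ, Fintype.card_fin] at h
    simp only [Finset.mem_sdiff, hx, true_and, Finset.sum_boole, Nat.cast_id]
    simp only [not_exists] at h
    refine Nat.eq_sub_of_add_eq' ?_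
    convert h
  · rw [if_neg hx, mul_zero]
    refine Finset.sum_eq_zero fun l _ => if_neg fun h => hx fun j => ?_
    exact (Finset.mem_sdiff.1 (h j)).1

/-- If `A = A₁ ∪ ⋯ ∪ A_k` with each `Aᵢ` contained in a coset `gᵢ + H` of a subgroup `H`,
the cosets being pairwise distinct, and likewise `B = B₁ ∪ ⋯ ∪ B_k` with each `Bᵢ` in a
coset `g'ᵢ + H`, those cosets pairwise distinct, and if for each `i` the sets `A ∖ Aᵢ`
and `B ∖ Bᵢ` are translates of one another, then `A` and `B` are `(k-1)`-indistinguishable. -/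
theorem stmt1 {G : Type*} [Fintype G] [AddCommGroup G] [DecidableEq G]
    (k : ℕ) (H : AddSubgroup G)
    (A B : Finset G) (As Bs : Fin k → Finset G) (g g' : Fin k → G)
    (hA : A = Finset.univ.biUnion As)
    (hB : B = Finset.univ.biUnion Bs)
    (hAcoset : ∀ i, ∀ x ∈ As i, x - g i ∈ H)
    (hBcoset : ∀ i, ∀ x ∈ Bs i, x - g' i ∈ H)
    (hAdistinct : ∀ i j, i ≠ j → g i - g j ∉ H)
    (hBdistinct : ∀ i j, i ≠ j → g' i - g' j ∉ H)
    (htrans : ∀ i, ∃ z : G, (A \ As i).image (fun x => z + x) = B \ Bs i) :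
    Indist (k - 1) (indic A) (indic B) := by
  classical
  subst hA hB
  intro m hm
  funext s
  rcases Nat.eq_zero_or_pos m with rfl | hm0
  · simp [deck]
  have hr : #(univ.image fun j => (s j : G ⧸ H)) ≤ m := by
    simpa using Finset.card_image_le (s := univ) (f := fun j => (s j : G ⧸ H))
  refine Nat.eq_of_mul_eq_mul_left
    (show 0 < k - #(univ.image fun j => (s j : G ⧸ H)) by omega) ?_
  rw [← sum_deck_indic_sdiff H As g hAcoset hAdistinct,
    ← sum_deck_indic_sdiff H Bs g' hBcoset hBdistinct]
  refine Finset.sum_congr rfl fun l _ => ?_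
  obtain ⟨z, hz⟩ := htrans l
  rw [← hz, deck_indic_image_add]
end

section
/- Let k ≥ 3 be an integer and G a finite abelian group containing a subgroup H of index at least k. Suppose there are subgroups H₁, …, H_k of H and elements h₁, …, h_k of H such that the intersection ⋂ᵢ (hᵢ + Hᵢ) is empty, while for every j the intersection ⋂_{i≠j} (hᵢ + Hᵢ) is nonempty. Then the reconstruction number of G is at least k; that is, there exist subsets A, B ⊆ G which are (k−1)-indistinguishable but are not translates of one another. -/
open Finset

/-- If `H` has index at least `k`, then there are `k` elements in pairwise distinct cosets of `H`. -/
theorem exists_distinct_coset_reps {G : Type*} [Finite G] [AddCommGroup G] {k : ℕ}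
    {H : AddSubgroup G} (hindex : k ≤ H.index) :
    ∃ x : Fin k → G, ∀ i j, x i - x j ∈ H → i = j := by
  have : Fintype (G ⧸ H) := Fintype.ofFinite _
  have hcard : Fintype.card (Fin k) ≤ Fintype.card (G ⧸ H) := by
    simpa [AddSubgroup.index, Nat.card_eq_fintype_card] using hindex
  obtain ⟨e⟩ := Function.Embedding.nonempty_of_card_le hcard
  refine ⟨fun i => (e i).out, fun i j hij => e.injective ?_⟩
  have h : (((e j).out : G) : G ⧸ H) = ((e i).out : G) :=
    QuotientAddGroup.eq.2 (by rwa [neg_add_eq_sub])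
  simpa using h.symm

/-- Translating each coset of `H` by an element of `H` depending only on the coset preserves
decks. -/
theorem deck_indic_eq_of_coset_translations {G : Type*} [Fintype G] [AddCommGroup G]
    [DecidableEq G] (H : AddSubgroup G) {n : ℕ} (s : Fin n → G) (A B : Finset G)
    (h : ∀ g₀ : G, ∃ c ∈ H, ∀ g, g - g₀ ∈ H → ∀ i, (g + s i ∈ A ↔ g + c + s i ∈ B)) :
    deck n (indic A) s = deck n (indic B) s := by
  choose c hcH hc using h
  let r : G → G := fun g => (g : G ⧸ H).out
  have hr : ∀ g, g - r g ∈ H := fun g => by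
    rw [← neg_add_eq_sub]
    exact QuotientAddGroup.eq.1 (by simp [r])
  have hr_add : ∀ g a, a ∈ H → r (g + a) = r g := fun g a ha => by
    have : ((g + a : G) : G ⧸ H) = g := (QuotientAddGroup.eq.2 (by simpa using ha)).symm
    simp only [r, this]
  refine Finset.sum_bij' (fun g _ => g + c (r g)) (fun g _ => g - c (r g))
    (by simp) (by simp) ?_ ?_ ?_
  · intro g _
    simp [hr_add g _ (hcH _)]
  · intro g _
    simp [sub_eq_add_neg, hr_add g _ (neg_mem (hcH _))]
  · intro g _
    refine Finset.prod_congr rfl fun i _ => ?_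
    simp only [indic, hc (r g) g (hr g) i]

/-- If `a + K` is contained in `b + L` for subgroups `K` and `L`, then `K ≤ L`. -/
theorem le_of_translate_subset {G : Type*} [AddCommGroup G] {K L : AddSubgroup G} {a b : G}
    (h : ∀ g, g - a ∈ K → g - b ∈ L) : K ≤ L := fun u hu => by
  have h₁ := h (u + a) (by simpa using hu)
  have h₂ := h a (by simp)
  simpa using L.sub_mem h₁ h₂

/-- Let `k ≥ 3` and let `G` be a finite abelian group containing a subgroup `H` of index
at least `k`. Suppose there are subgroups `H₁,…,H_k` of `H` and elements `h₁,…,h_k ∈ H`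
with `⋂ᵢ (hᵢ + Hᵢ) = ∅` while every intersection omitting one index is nonempty.
Then the reconstruction number of `G` is at least `k`: there exist subsets `A, B ⊆ G`
which are `(k-1)`-indistinguishable but not translates of one another. -/
theorem stmt2 {G : Type*} [Fintype G] [AddCommGroup G] [DecidableEq G]
    (k : ℕ) (hk : 3 ≤ k) (H : AddSubgroup G) (hindex : k ≤ H.index)
    (Hs : Fin k → AddSubgroup G) (hHs : ∀ i, Hs i ≤ H)
    (hs : Fin k → G) (hhs : ∀ i, hs i ∈ H)
    (hempty : (⋂ i, ((fun x => hs i + x) '' (Hs i : Set G))) = ∅)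
    (hnonempty : ∀ j, (⋂ i, ⋂ (_ : i ≠ j), ((fun x => hs i + x) '' (Hs i : Set G))).Nonempty) :
    ∃ A B : Finset G, Indist (k - 1) (indic A) (indic B) ∧
      ¬ ∃ z : G, B = A.image (fun x => z + x) := by
  have hmem : ∀ i g, g ∈ ((fun x => hs i + x) '' (Hs i : Set G)) ↔ g - hs i ∈ Hs i := by
    intro i g
    constructor
    · rintro ⟨u, hu, rfl⟩
      simpa using hu
    · intro h
      exact ⟨g - hs i, h, by simp⟩
  have hemp : ∀ z, ¬ ∀ i, z - hs i ∈ Hs i := by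
    intro z hz
    have : z ∈ (⋂ i, ((fun x => hs i + x) '' (Hs i : Set G))) :=
      Set.mem_iInter.2 fun i => (hmem i z).2 (hz i)
    rw [hempty] at this
    exact this
  have hne : ∀ j, ∃ c, ∀ i, i ≠ j → c - hs i ∈ Hs i := by
    intro j
    obtain ⟨c, hc⟩ := hnonempty j
    simp only [Set.mem_iInter] at hc
    exact ⟨c, fun i hi => (hmem i c).1 (hc i hi)⟩
  have hinj : ∀ i j, Hs i = Hs j → i = j := by
    intro i j hij
    by_contra hne_ij
    obtain ⟨l, hl⟩ : ∃ l, l ∉ ({i, j} : Finset (Fin k)) := by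
      by_contra! hall
      have h₁ : (Finset.univ : Finset (Fin k)).card ≤ ({i, j} : Finset (Fin k)).card :=
        Finset.card_le_card fun l _ => hall l
      have h₂ := Finset.card_le_two (a := i) (b := j)
      simp only [Finset.card_univ, Fintype.card_fin] at h₁
      omega
    simp only [Finset.mem_insert, Finset.mem_singleton, not_or] at hl
    obtain ⟨c, hc⟩ := hne l
    obtain ⟨d, hd⟩ := hne j
    refine hemp d fun m => ?_
    by_cases hm : m = j
    · subst hm
      have h₁ := hc i (Ne.symm hl.1)
      have h₂ := hc m (Ne.symm hl.2)
      have h₃ := hd i hne_ij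
      rw [hij] at h₁ h₃
      have h₄ := (Hs m).add_mem ((Hs m).sub_mem h₃ h₁) h₂
      convert h₄ using 1
      abel
    · exact hd m hm
  obtain ⟨x, hx⟩ := exists_distinct_coset_reps hindex
  classical
  let A : Finset G := Finset.univ.filter fun g => ∃ i, g - x i ∈ Hs i
  let B : Finset G := Finset.univ.filter fun g => ∃ i, g - (x i + hs i) ∈ Hs i
  have hA : ∀ g, g ∈ A ↔ ∃ i, g - x i ∈ Hs i := by simp [A]
  have hB : ∀ g, g ∈ B ↔ ∃ i, g - (x i + hs i) ∈ Hs i := by simp [B]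
  refine ⟨A, B, ?_, ?_⟩
  · intro n hn
    funext s
    refine deck_indic_eq_of_coset_translations H s A B fun g₀ => ?_
    obtain ⟨j₀, hj₀⟩ : ∃ j, ∀ i, g₀ + s i - x j ∉ H := by
      by_contra! hall
      choose f hf using hall
      have hf_inj : Function.Injective f := by
        intro a b hab
        have h₁ := hf a
        have h₂ := hf b
        rw [← hab] at h₂
        refine hx a b ?_
        have := H.sub_mem h₂ h₁
        convert this using 1
        abel
      have := Fintype.card_le_of_injective f hf_inj
      simp only [Fintype.card_fin] at this
      omega
    obtain ⟨c, hc⟩ := hne j₀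
    have hcH : c ∈ H := by
      have : Nontrivial (Fin k) := Fin.nontrivial_iff_two_le.2 (by omega)
      obtain ⟨i, hi⟩ := exists_ne j₀
      simpa using H.add_mem (hHs i (hc i hi)) (hhs i)
    refine ⟨c, hcH, fun g hg i => ?_⟩
    rw [hA, hB]
    have hne_of_mem : ∀ j, g + s i - x j ∈ H → j ≠ j₀ := by
      rintro j hj rfl
      refine hj₀ i ?_
      have := H.sub_mem hj hg
      convert this using 1
      abel
    constructor
    · rintro ⟨j, hj⟩
      refine ⟨j, ?_⟩
      have := (Hs j).add_mem hj (hc j (hne_of_mem j (hHs j hj)))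
      convert this using 1
      abel
    · rintro ⟨j, hj⟩
      have hjH : g + s i - x j ∈ H := by
        have := H.add_mem (H.sub_mem (hHs j hj) hcH) (hhs j)
        convert this using 1
        abel
      refine ⟨j, ?_⟩
      have := (Hs j).sub_mem hj (hc j (hne_of_mem j hjH))
      convert this using 1
      abel
  · rintro ⟨z, hz⟩
    have hzAB : ∀ g, z + g ∈ B ↔ g ∈ A := by
      intro g
      simp [hz]
    refine hemp z fun i => ?_
    obtain ⟨j, hj⟩ := (hB _).1 ((hzAB (x i)).2 ((hA _).2 ⟨i, by simp⟩))
    have hzH : z + x i - x j ∈ H := by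
      have := H.add_mem (hHs j hj) (hhs j)
      convert this using 1
      abel
    have hij : Hs i = Hs j := by
      apply le_antisymm
      · refine le_of_translate_subset (a := z + x i) (b := x j + hs j) fun g hg => ?_
        obtain ⟨l, hl⟩ := (hB (z + (g - z))).1 ((hzAB _).2 ((hA _).2 ⟨i, by
          convert hg using 1
          abel⟩))
        rw [add_sub_cancel] at hl
        have hjl : j = l := by
          refine hx j l ?_
          have := H.sub_mem (H.add_mem (H.add_mem (hHs l hl) (hhs l)) (neg_mem (hHs i hg))) hzH
          convert this using 1
          abel
        rwa [hjl]
      · refine le_of_translate_subset (a := x j + hs j) (b := z + x i) fun g hg => ?_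
        obtain ⟨l, hl⟩ := (hA (g - z)).1 ((hzAB _).1 ((hB _).2 ⟨j, by
          convert hg using 1
          abel⟩))
        have hil : i = l := by
          refine hx i l ?_
          have := H.add_mem (H.sub_mem (H.sub_mem (hHs l hl) (hHs j hg)) (hhs j)) hzH
          convert this using 1
          abel
        rw [hil]
        convert hl using 1
        abel
    obtain rfl := hinj i j hij
    convert hj using 1
    abel
end

section
/- For every integer k ≥ 2, the group 𝔽₂^{k−1} contains k cosets of subgroups with empty intersection such that the intersection of any k−1 of them is nonempty: there exist subgroups H₁, …, H_k of 𝔽₂^{k−1} and elements h₁, …, h_k ∈ 𝔽₂^{k−1} such that ⋂ᵢ (hᵢ + Hᵢ) = ∅, while for every j the intersection ⋂_{i≠j} (hᵢ + Hᵢ) is nonempty. -/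
theorem AddMonoidHom.mem_image_add_ker_iff {G A : Type*} [AddCommGroup G] [AddCommGroup A]
    (f : G →+ A) (h x : G) :
    x ∈ (fun y => h + y) '' (f.ker : Set G) ↔ f x = f h := by
  constructor
  · rintro ⟨y, hy, rfl⟩
    have hy' : f y = 0 := hy
    simp [hy']
  · intro hx
    refine ⟨x - h, ?_, add_sub_cancel h x⟩
    simp [AddMonoidHom.mem_ker, hx]

/-- The coordinate functionals on `𝔽₂^n`, followed by the sum of all coordinates. -/
def coordinatesAndSum (n : ℕ) : Fin (n + 1) → ((Fin n → ZMod 2) →+ ZMod 2) :=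
  Fin.lastCases (∑ i, Pi.evalAddMonoidHom (fun _ => ZMod 2) i)
    (fun i => Pi.evalAddMonoidHom (fun _ => ZMod 2) i)

theorem coordinatesAndSum_last (n : ℕ) (x : Fin n → ZMod 2) :
    coordinatesAndSum n (Fin.last n) x = ∑ i, x i := by
  simp [coordinatesAndSum]

theorem coordinatesAndSum_castSucc (n : ℕ) (i : Fin n) (x : Fin n → ZMod 2) :
    coordinatesAndSum n i.castSucc x = x i := by
  simp [coordinatesAndSum]


/-- For every integer `k ≥ 2`, the group `𝔽₂^(k-1)` contains `k` cosets of subgroups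
with empty intersection such that the intersection of any `k-1` of them is nonempty. -/
theorem stmt3 (k : ℕ) (hk : 2 ≤ k) :
    ∃ (Hs : Fin k → AddSubgroup (Fin (k - 1) → ZMod 2))
      (hs : Fin k → (Fin (k - 1) → ZMod 2)),
      (⋂ i, (fun x => hs i + x) '' ((Hs i : Set (Fin (k - 1) → ZMod 2)))) = ∅ ∧
      ∀ j, (⋂ i, ⋂ (_ : i ≠ j),
        (fun x => hs i + x) '' ((Hs i : Set (Fin (k - 1) → ZMod 2)))).Nonempty := by
  obtain ⟨n, rfl⟩ : ∃ n, k = n + 2 := ⟨k - 2, by omega⟩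
  change ∃ (Hs : Fin (n + 1 + 1) → AddSubgroup (Fin (n + 1) → ZMod 2))
      (hs : Fin (n + 1 + 1) → (Fin (n + 1) → ZMod 2)),
      (⋂ i, (fun x => hs i + x) '' ((Hs i : Set (Fin (n + 1) → ZMod 2)))) = ∅ ∧
      ∀ j, (⋂ i, ⋂ (_ : i ≠ j),
        (fun x => hs i + x) '' ((Hs i : Set (Fin (n + 1) → ZMod 2)))).Nonempty
  refine ⟨fun i => (coordinatesAndSum (n + 1) i).ker,
    Fin.lastCases (Pi.single 0 1) (fun _ => 0), ?_, fun j => ?_⟩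
  · refine Set.eq_empty_of_forall_notMem fun x hx => ?_
    simp only [Set.mem_iInter, AddMonoidHom.mem_image_add_ker_iff] at hx
    have hsum := hx (Fin.last _)
    have hcoord : ∀ i, x i = 0 := fun i => by
      simpa [coordinatesAndSum_castSucc] using hx i.castSucc
    simp [coordinatesAndSum_last, hcoord] at hsum
  · simp only [Set.Nonempty, Set.mem_iInter, AddMonoidHom.mem_image_add_ker_iff]
    induction j using Fin.lastCases with
    | last =>
      refine ⟨0, fun i => ?_⟩
      induction i using Fin.lastCases with
      | last => exact fun h => absurd rfl h
      | cast i => simp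
    | cast j =>
      refine ⟨Pi.single j 1, fun i => ?_⟩
      induction i using Fin.lastCases with
      | last => simp [coordinatesAndSum_last]
      | cast i =>
        intro hij
        have hne : i ≠ j := fun h => hij (congrArg Fin.castSucc h)
        simp [coordinatesAndSum_castSucc, hne]
end

section
/- For positive integers n and k with 2^{n+1−k} ≥ k (interpreted as a real inequality, allowing negative exponent), the reconstruction number of 𝔽₂^n is at least k; that is, there exist subsets A, B ⊆ 𝔽₂^n which are (k−1)-indistinguishable but are not translates of one another. -/
open Finset

/-- The functionals on `𝔽₂^d` given by the coordinates (`some j`) and their sum (`none`). -/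
def coordOrSum {d : ℕ} (o : Option (Fin d)) : (Fin d → ZMod 2) →+ ZMod 2 :=
  o.elim (∑ j, Pi.evalAddMonoidHom _ j) (Pi.evalAddMonoidHom _)

/-- The prescription of values of `coordOrSum` that no vector satisfies: all coordinates vanish
but their sum is `1`. -/
def sumShift {d : ℕ} (o : Option (Fin d)) : ZMod 2 :=
  o.elim 1 0

@[simp]
lemma coordOrSum_none {d : ℕ} (v : Fin d → ZMod 2) : coordOrSum none v = ∑ j, v j := by
  simp [coordOrSum]

@[simp]
lemma coordOrSum_some {d : ℕ} (j : Fin d) (v : Fin d → ZMod 2) :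
    coordOrSum (some j) v = v j := rfl

/-- The prescription `sumShift` can be met away from any single index. -/
lemma exists_coordOrSum_eq_sumShift {d : ℕ} (o : Option (Fin d)) :
    ∃ v : Fin d → ZMod 2, ∀ p ≠ o, coordOrSum p v = sumShift p := by
  cases o with
  | none =>
    refine ⟨0, fun p hp => ?_⟩
    cases p with
    | none => exact absurd rfl hp
    | some i => rfl
  | some j =>
    refine ⟨Pi.single j 1, fun p hp => ?_⟩
    cases p with
    | none => simp [sumShift]
    | some i =>
      have hij : i ≠ j := fun hij => hp (by rw [hij])
      simp [sumShift, hij]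

/-- The prescription `sumShift` cannot be met at all indices. -/
lemma not_forall_coordOrSum_eq_sumShift {d : ℕ} (v : Fin d → ZMod 2) :
    ¬ ∀ p, coordOrSum p v = sumShift p := by
  intro hv
  have hz : ∀ j, v j = 0 := fun j => hv (some j)
  have hs := hv none
  simp [hz, sumShift] at hs

/-- The points `g` at which the functional selected by `t g` takes the value prescribed
by `c`. -/
def levelSet {G : Type*} [Fintype G] [AddCommGroup G] {d : ℕ} (q : G →+ (Fin d → ZMod 2))
    (t : G → Option (Fin d)) (c : Option (Fin d) → ZMod 2) : Finset G :=
  {g | coordOrSum (t g) (q g) = c (t g)}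

section

variable {G : Type*} [Fintype G] [AddCommGroup G] [DecidableEq G] {d : ℕ}
  (q : G →+ (Fin d → ZMod 2)) (l : (Fin d → ZMod 2) → G) (t : G → Option (Fin d))

lemma indist_levelSet (hq : ∀ v, q (l v) = v) (ht : ∀ g v, t (g + l v) = t g) :
    Indist d (indic (levelSet q t 0)) (indic (levelSet q t sumShift)) := by
  intro i hi
  funext s
  have hmiss : ∀ g, ∃ o : Option (Fin d), ∀ j, t (g + s j) ≠ o := by
    intro g
    by_contra! hsurj
    have := Fintype.card_le_of_surjective (fun j => t (g + s j)) hsurj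
    simp at this
    omega
  have hshift : ∀ τ : Fin i → Option (Fin d), ∃ v : Fin d → ZMod 2,
      (∃ o, ∀ j, τ j ≠ o) → ∀ j, coordOrSum (τ j) v = sumShift (τ j) := by
    intro τ
    by_cases hτ : ∃ o, ∀ j, τ j ≠ o
    · obtain ⟨o, ho⟩ := hτ
      obtain ⟨v, hv⟩ := exists_coordOrSum_eq_sumShift o
      exact ⟨v, fun _ j => hv _ (ho j)⟩
    · exact ⟨0, fun h => absurd h hτ⟩
  choose V hV using hshift
  let τ : G → Fin i → Option (Fin d) := fun g j => t (g + s j)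
  have hτ : ∀ g v, τ (g + l v) = τ g := fun g v => by
    funext j
    simp only [τ]
    rw [add_right_comm, ht]
  let σ : G → G := fun g => g + l (V (τ g))
  have hσ : Function.Injective σ := by
    intro g g' hgg
    have h1 : τ g = τ g' := by
      rw [← hτ g (V (τ g)), ← hτ g' (V (τ g'))]
      exact congrArg τ hgg
    have h2 : g + l (V (τ g)) = g' + l (V (τ g')) := hgg
    rw [h1] at h2
    exact add_right_cancel h2
  refine Fintype.sum_bijective σ (Finite.injective_iff_bijective.mp hσ) _ _ fun g => ?_
  refine Finset.prod_congr rfl fun j _ => ?_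
  have h1 : t (σ g + s j) = t (g + s j) := congrFun (hτ g _) j
  have h2 : coordOrSum (t (g + s j)) (V (τ g)) = sumShift (t (g + s j)) := hV (τ g) (hmiss g) j
  have h3 : q (σ g + s j) = q (g + s j) + V (τ g) := by
    simp only [σ, map_add, hq]
    abel
  simp [indic, levelSet, h1, h3, -map_add]
  simp only [map_add (coordOrSum _), h2, add_eq_right]

lemma not_translate_levelSet (hq : ∀ v, q (l v) = v) (ht : ∀ g v, t (g + l v) = t g)
    (hts : Function.Surjective t) :
    ¬ ∃ z : G, levelSet q t sumShift = (levelSet q t 0).image (fun x => z + x) := by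
  rintro ⟨z, hz⟩
  have hmem : ∀ x, coordOrSum (t (z + x)) (q (z + x)) = sumShift (t (z + x)) ↔
      coordOrSum (t x) (q x) = 0 := by
    intro x
    have := Finset.ext_iff.mp hz (z + x)
    simpa [levelSet, -map_add] using this
  have hzmod : ∀ a b c : ZMod 2, (a = b ↔ c = 0) → a - b = c := by decide
  have hval : ∀ x, coordOrSum (t (z + x)) (q (z + x)) - sumShift (t (z + x)) =
      coordOrSum (t x) (q x) := fun x => hzmod _ _ _ (hmem x)
  have hfun : ∀ x v, coordOrSum (t (z + x)) v = coordOrSum (t x) v := by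
    intro x v
    have h1 := hval x
    have h2 := hval (x + l v)
    rw [map_add q, map_add (coordOrSum _)] at h1
    rw [← add_assoc, ht, ht, map_add q, map_add q, map_add q x, hq, map_add (coordOrSum _),
      map_add (coordOrSum _), map_add (coordOrSum _)] at h2
    linear_combination h2 - h1
  refine not_forall_coordOrSum_eq_sumShift (q z) fun p => ?_
  obtain ⟨y, rfl⟩ := hts p
  have h1 := hval (y - z)
  rw [← hfun (y - z), add_sub_cancel, map_sub q, map_sub (coordOrSum _)] at h1
  linear_combination h1

end

/-- For positive integers `n`, `k` with `2^(n+1−k) ≥ k` (as a real inequality, allowing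
negative exponent), the reconstruction number of `𝔽₂^n` is at least `k`: there exist
subsets `A, B ⊆ 𝔽₂^n` which are `(k-1)`-indistinguishable but not translates. -/
theorem stmt4 (n k : ℕ) (hn : 0 < n) (hk : 0 < k)
    (h : (k : ℝ) ≤ (2 : ℝ) ^ ((n : ℝ) + 1 - (k : ℝ))) :
    ∃ A B : Finset (Fin n → ZMod 2),
      Indist (k - 1) (indic A) (indic B) ∧
      ¬ ∃ z : Fin n → ZMod 2, B = A.image (fun x => z + x) := by
  have hkn : k ≤ n + 1 := by
    by_contra! hlt
    have hlt' : (n : ℝ) + 1 < k := by exact_mod_cast hlt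
    have h1 : (2 : ℝ) ^ ((n : ℝ) + 1 - (k : ℝ)) < 1 :=
      Real.rpow_lt_one_of_one_lt_of_neg (by norm_num) (by linarith)
    have h2 : (1 : ℝ) ≤ k := by exact_mod_cast hk
    linarith
  obtain ⟨d, rfl⟩ : ∃ d, k = d + 1 := ⟨k - 1, by omega⟩
  obtain ⟨m, rfl⟩ : ∃ m, n = d + m := ⟨n - d, by omega⟩
  have hcard : d + 1 ≤ 2 ^ m := by
    have he : ((d + m : ℕ) : ℝ) + 1 - ((d + 1 : ℕ) : ℝ) = (m : ℝ) := by push_cast; ring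
    rw [he, Real.rpow_natCast] at h
    exact_mod_cast h
  obtain ⟨e⟩ : Nonempty (Option (Fin d) ↪ (Fin m → ZMod 2)) :=
    Function.Embedding.nonempty_of_card_le (by simpa using hcard)
  obtain ⟨r, hr⟩ : ∃ r : (Fin m → ZMod 2) → Option (Fin d), Function.Surjective r :=
    ⟨Function.invFun e, Function.invFun_surjective e.injective⟩
  let q : (Fin (d + m) → ZMod 2) →+ (Fin d → ZMod 2) :=
    { toFun := fun g i => g (Fin.castAdd m i)
      map_zero' := rfl
      map_add' := fun _ _ => rfl }
  let t : (Fin (d + m) → ZMod 2) → Option (Fin d) := fun g => r fun i => g (Fin.natAdd d i)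
  let l : (Fin d → ZMod 2) → (Fin (d + m) → ZMod 2) := fun v => Fin.append v 0
  have hq : ∀ v, q (l v) = v := fun v => by ext i; simp [q, l]
  have ht : ∀ g v, t (g + l v) = t g := fun g v => by simp [t, l]
  have hts : Function.Surjective t := fun o => by
    obtain ⟨x, hx⟩ := hr o
    exact ⟨Fin.append 0 x, by simpa [t] using hx⟩
  exact ⟨levelSet q t 0, levelSet q t sumShift, indist_levelSet q l t hq ht,
    not_translate_levelSet q l t hq ht hts⟩
end

section
/- Two multisets f and g from 𝔽₂^n are k-indistinguishable if and only if for every i ≤ k and every sequence x₁, …, x_i of elements of 𝔽₂^n with x₁ + ⋯ + x_i = 0, one has f̂(x₁)⋯f̂(x_i) = ĝ(x₁)⋯ĝ(x_i). (In other words, the k-deck of f carries exactly the same information as the products of Fourier coefficients of f over zero-sum sequences of length at most k.) -/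
open Finset

/-- The character pairing `⟨x,y⟩ = (−1)^(x₁y₁+⋯+x_ny_n) ∈ ℤ` on `𝔽₂^n`. -/
def chr {n : ℕ} (x y : Fin n → ZMod 2) : ℤ :=
  (-1 : ℤ) ^ (∑ i, x i * y i).val

/-- The Fourier transform of a multiset `φ : 𝔽₂^n → ℕ`, viewed as taking values in `ℤ`. -/
def ftN {n : ℕ} (φ : (Fin n → ZMod 2) → ℕ) : (Fin n → ZMod 2) → ℤ :=
  fun x => ∑ y, (φ y : ℤ) * chr x y

theorem neg_one_pow_val_add (a b : ZMod 2) :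
    (-1 : ℤ) ^ (a + b).val = (-1) ^ a.val * (-1) ^ b.val := by
  revert a b; decide

theorem chr_comm {n : ℕ} (x y : Fin n → ZMod 2) : chr x y = chr y x := by
  simp only [chr, mul_comm]

theorem chr_zero_left {n : ℕ} (y : Fin n → ZMod 2) : chr 0 y = 1 := by
  simp [chr]

theorem chr_add_right {n : ℕ} (x y z : Fin n → ZMod 2) :
    chr x (y + z) = chr x y * chr x z := by
  simp only [chr, Pi.add_apply, mul_add, sum_add_distrib, neg_one_pow_val_add]

theorem chr_add_left {n : ℕ} (x y z : Fin n → ZMod 2) :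
    chr (x + y) z = chr x z * chr y z := by
  rw [chr_comm, chr_add_right, chr_comm z x, chr_comm z y]

theorem chr_sum_left {n : ℕ} {ι : Type*} (s : Finset ι) (x : ι → Fin n → ZMod 2)
    (y : Fin n → ZMod 2) : chr (∑ j ∈ s, x j) y = ∏ j ∈ s, chr (x j) y := by
  induction s using Finset.cons_induction with
  | empty => simp [chr_zero_left]
  | cons a s ha ih => rw [sum_cons, prod_cons, chr_add_left, ih]

/-- Orthogonality of characters. -/
theorem sum_chr {n : ℕ} (x : Fin n → ZMod 2) :
    ∑ y, chr x y = if x = 0 then (2 : ℤ) ^ n else 0 := by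
  split_ifs with h
  · simp [h, chr_zero_left]
  · obtain ⟨i, hi⟩ := Function.ne_iff.mp h
    have hi1 : x i = 1 := by
      have h2 : ∀ a : ZMod 2, a ≠ 0 → a = 1 := by decide
      exact h2 _ hi
    obtain ⟨e, hs⟩ : ∃ e, chr x e = -1 :=
      ⟨Pi.single i 1, by simp [chr, Pi.single_apply, hi1, ZMod.val_one]⟩
    have key : ∑ y, chr x (y + e) = ∑ y, chr x y :=
      Equiv.sum_comp (Equiv.addRight e) (chr x)
    simp only [chr_add_right, hs, mul_neg, mul_one, sum_neg_distrib] at key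
    linarith

theorem add_self_eq_zero_of_zmod_two {n : ℕ} (x : Fin n → ZMod 2) : x + x = 0 := by
  ext i; exact CharTwo.add_self_eq_zero _

theorem add_eq_zero_iff_eq_of_zmod_two {n : ℕ} (x y : Fin n → ZMod 2) :
    x + y = 0 ↔ x = y := by
  rw [← add_self_eq_zero_of_zmod_two y, add_left_inj]

theorem sum_translate_mul_chr {n : ℕ} (φ : (Fin n → ZMod 2) → ℕ) (x g : Fin n → ZMod 2) :
    ∑ s, (φ (g + s) : ℤ) * chr x s = chr x g * ftN φ x := by
  rw [ftN, ← Equiv.sum_comp (Equiv.addLeft g) (fun y => (φ y : ℤ) * chr x y), mul_sum]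
  refine sum_congr rfl fun s _ => ?_
  have h : chr x g * chr x g = 1 := by
    rw [← chr_add_right, add_self_eq_zero_of_zmod_two, chr_comm, chr_zero_left]
  simp only [Equiv.coe_addLeft, chr_add_right]
  linear_combination -(φ (g + s) : ℤ) * chr x s * h

/-- The Fourier transform of the deck is supported on zero-sum sequences, where it is
proportional to the product of Fourier coefficients. -/
theorem sum_deck_mul_chr {n k : ℕ} (φ : (Fin n → ZMod 2) → ℕ)
    (x : Fin k → Fin n → ZMod 2) :
    ∑ s, (deck k φ s : ℤ) * ∏ j, chr (x j) (s j) =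
      (if ∑ j, x j = 0 then (2 : ℤ) ^ n else 0) * ∏ j, ftN φ (x j) := by
  simp only [deck, Nat.cast_sum, Nat.cast_prod, sum_mul, ← prod_mul_distrib]
  rw [sum_comm, ← sum_chr, sum_mul]
  refine sum_congr rfl fun g _ => ?_
  rw [chr_sum_left, ← prod_mul_distrib]
  simp only [← sum_translate_mul_chr, Fintype.prod_sum]

/-- Fourier inversion on `(𝔽₂^n)^k`. -/
theorem sum_sum_mul_chr {n k : ℕ} (F : (Fin k → Fin n → ZMod 2) → ℤ)
    (t : Fin k → Fin n → ZMod 2) :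
    ∑ x : Fin k → Fin n → ZMod 2,
      (∑ s, F s * ∏ j, chr (x j) (s j)) * ∏ j, chr (x j) (t j) =
      ((2 : ℤ) ^ n) ^ k * F t := by
  simp only [sum_mul, mul_assoc, ← prod_mul_distrib, ← chr_add_right]
  rw [sum_comm]
  simp only [← mul_sum]
  have h (s : Fin k → Fin n → ZMod 2) :
      ∑ x : Fin k → Fin n → ZMod 2, ∏ j, chr (x j) (s j + t j) =
        if s = t then ((2 : ℤ) ^ n) ^ k else 0 := by
    rw [← Fintype.prod_sum (fun j y => chr y (s j + t j))]
    simp only [chr_comm _ (_ + _), sum_chr, add_eq_zero_iff_eq_of_zmod_two]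
    split_ifs with hst
    · simp [hst]
    · obtain ⟨j, hj⟩ := Function.ne_iff.mp hst
      exact prod_eq_zero (mem_univ j) (if_neg hj)
  simp [h, mul_comm]

theorem deck_eq_iff {n k : ℕ} (f g : (Fin n → ZMod 2) → ℕ) :
    deck k f = deck k g ↔ ∀ x : Fin k → Fin n → ZMod 2, ∑ j, x j = 0 →
      ∏ j, ftN f (x j) = ∏ j, ftN g (x j) := by
  constructor
  · intro h x hx
    have hfg := sum_deck_mul_chr f x
    rw [h, sum_deck_mul_chr g x, if_pos hx] at hfg
    exact (mul_left_cancel₀ (by positivity) hfg).symm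
  · intro h
    ext t
    have hD (x : Fin k → Fin n → ZMod 2) :
        ∑ s, (deck k f s : ℤ) * ∏ j, chr (x j) (s j) =
          ∑ s, (deck k g s : ℤ) * ∏ j, chr (x j) (s j) := by
      rw [sum_deck_mul_chr, sum_deck_mul_chr]
      split_ifs with hx
      · rw [h x hx]
      · simp
    have hf := sum_sum_mul_chr (fun s => (deck k f s : ℤ)) t
    simp only [hD] at hf
    rw [sum_sum_mul_chr (fun s => (deck k g s : ℤ)) t] at hf
    exact_mod_cast (mul_left_cancel₀ (by positivity) hf).symm

/-- Multisets `f` and `g` from `𝔽₂^n` are `k`-indistinguishable if and only if for every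
`i ≤ k` and every zero-sum sequence `x₁,…,x_i` in `𝔽₂^n`, the products of Fourier
coefficients agree: `f̂(x₁)⋯f̂(x_i) = ĝ(x₁)⋯ĝ(x_i)`. -/
theorem stmt7 {n : ℕ} (k : ℕ) (f g : (Fin n → ZMod 2) → ℕ) :
    Indist k f g ↔
      ∀ i, i ≤ k → ∀ x : Fin i → (Fin n → ZMod 2), (∑ j, x j) = 0 →
        ∏ j, ftN f (x j) = ∏ j, ftN g (x j) := by
  exact forall₂_congr fun _ _ => deck_eq_iff f g
end

section
/- Let k ≥ 2 and let f, g be multisets from 𝔽₂^n which are k-indistinguishable. Then for every 𝔽₂-linear map θ : 𝔽₂^n → 𝔽₂^p, the image multisets θf and θg are k-indistinguishable. -/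
open Finset

/-- The image multiset `θφ(x) = ∑_{z : θz = x} φ(z)` of `φ` under a linear map `θ`. -/
def pushN {n p : ℕ} (θ : (Fin n → ZMod 2) →ₗ[ZMod 2] (Fin p → ZMod 2))
    (φ : (Fin n → ZMod 2) → ℕ) : (Fin p → ZMod 2) → ℕ :=
  fun x => ∑ z ∈ Finset.univ.filter (fun z => θ z = x), φ z

theorem pushN_map_add {n p : ℕ} (θ : (Fin n → ZMod 2) →ₗ[ZMod 2] (Fin p → ZMod 2))
    (φ : (Fin n → ZMod 2) → ℕ) (a : Fin n → ZMod 2) (y : Fin p → ZMod 2) :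
    pushN θ φ (θ a + y) = pushN θ (fun z => φ (a + z)) y := by
  unfold pushN
  rw [Finset.sum_filter, Finset.sum_filter, ← Equiv.sum_comp (Equiv.addLeft a)]
  simp

/-- Averaging over translations expresses the deck of the image multiset through the deck of
the original multiset. -/
theorem card_mul_deck_pushN {n p : ℕ} (θ : (Fin n → ZMod 2) →ₗ[ZMod 2] (Fin p → ZMod 2))
    (φ : (Fin n → ZMod 2) → ℕ) (i : ℕ) (s : Fin i → Fin p → ZMod 2) :
    Fintype.card (Fin n → ZMod 2) * deck i (pushN θ φ) s =
      ∑ x, ∑ z ∈ Fintype.piFinset fun j => Finset.univ.filter fun z => θ z = x + s j,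
        deck i φ z := by
  have translate (a : Fin n → ZMod 2) : deck i (pushN θ φ) s =
      ∑ x, ∑ z ∈ Fintype.piFinset fun j => Finset.univ.filter fun z => θ z = x + s j,
        ∏ j, φ (a + z j) := by
    unfold deck
    rw [← Equiv.sum_comp (Equiv.addLeft (θ a))]
    refine Finset.sum_congr rfl fun x _ => ?_
    simp only [Equiv.coe_addLeft, add_assoc, pushN_map_add]
    exact Finset.prod_univ_sum _ _
  calc
    _ = ∑ _a : Fin n → ZMod 2, deck i (pushN θ φ) s := by simp
    _ = ∑ a : Fin n → ZMod 2, ∑ x,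
        ∑ z ∈ Fintype.piFinset fun j => Finset.univ.filter fun z => θ z = x + s j,
          ∏ j, φ (a + z j) := Finset.sum_congr rfl fun a _ => translate a
    _ = _ := by
      rw [Finset.sum_comm]
      exact Finset.sum_congr rfl fun x _ => Finset.sum_comm

/-- If multisets `f` and `g` from `𝔽₂^n` are `k`-indistinguishable (`k ≥ 2`), then for
every `𝔽₂`-linear map `θ : 𝔽₂^n → 𝔽₂^p` the images `θf` and `θg` are
`k`-indistinguishable. -/
theorem stmt8 {n p : ℕ} (k : ℕ) (hk : 2 ≤ k) (f g : (Fin n → ZMod 2) → ℕ)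
    (hfg : Indist k f g) (θ : (Fin n → ZMod 2) →ₗ[ZMod 2] (Fin p → ZMod 2)) :
    Indist k (pushN θ f) (pushN θ g) := by
  intro i hi
  funext s
  apply Nat.eq_of_mul_eq_mul_left (Fintype.card_pos (α := Fin n → ZMod 2))
  rw [card_mul_deck_pushN, card_mul_deck_pushN, hfg i hi]
end

section
/- Let k ≥ 2 and let f, g be multisets from 𝔽₂^n which are k-distinguishable. Then there exists an 𝔽₂-linear map θ : 𝔽₂^n → 𝔽₂^{k−1} such that the image multisets θf and θg are k-distinguishable. -/
open Finset

/-- The nontrivial additive character of `𝔽₂`, with values in `ℤ`. -/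
def signChar : AddChar (ZMod 2) ℤ where
  toFun a := if a = 0 then 1 else -1
  map_zero_eq_one' := by decide
  map_add_eq_mul' := by decide

/-- The Fourier transform of a multiset from `𝔽₂^n`. -/
def signFourier {n : ℕ} (φ : (Fin n → ZMod 2) → ℕ) (ξ : Fin n → ZMod 2) : ℤ :=
  ∑ x, signChar (ξ ⬝ᵥ x) * φ x

theorem signChar_sum {ι : Type*} (s : Finset ι) (a : ι → ZMod 2) :
    signChar (∑ i ∈ s, a i) = ∏ i ∈ s, signChar (a i) := by
  classical
  induction s using Finset.induction_on with
  | empty => simp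
  | insert i s hi ih => rw [sum_insert hi, prod_insert hi, AddChar.map_add_eq_mul, ih]

theorem sum_signChar_dotProduct {n : ℕ} (x : Fin n → ZMod 2) :
    ∑ ξ : Fin n → ZMod 2, signChar (ξ ⬝ᵥ x) = if x = 0 then 2 ^ n else 0 := by
  have h : ∑ ξ : Fin n → ZMod 2, signChar (ξ ⬝ᵥ x) = ∏ l, ∑ a, signChar (a * x l) := by
    simp only [dotProduct, signChar_sum, Fintype.prod_sum]
  have h₂ : ∀ b : ZMod 2, ∑ a, signChar (a * b) = if b = 0 then 2 else 0 := by decide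
  simp only [h, h₂]
  split_ifs with hx
  · simp [hx]
  · obtain ⟨l, hl⟩ := Function.ne_iff.mp hx
    exact prod_eq_zero (mem_univ l) (if_neg hl)

/-- The Fourier transform of the deck of `φ` in terms of that of `φ`. -/
theorem sum_signChar_mul_deck {n i : ℕ} (φ : (Fin n → ZMod 2) → ℕ)
    (ξ : Fin i → Fin n → ZMod 2) :
    ∑ s, (∏ j, signChar (ξ j ⬝ᵥ s j)) * (deck i φ s : ℤ) =
      (if ∑ j, ξ j = 0 then 2 ^ n else 0) * ∏ j, signFourier φ (ξ j) := by
  have hsq : ∀ a : ZMod 2, signChar a * signChar a = 1 := by decide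
  have key : ∀ x : Fin n → ZMod 2,
      ∑ s : Fin i → Fin n → ZMod 2,
        (∏ j, signChar (ξ j ⬝ᵥ s j)) * ∏ j, (φ (x + s j) : ℤ) =
      signChar (x ⬝ᵥ ∑ j, ξ j) * ∏ j, signFourier φ (ξ j) := by
    intro x
    simp only [signFourier, ← prod_mul_distrib, Fintype.prod_sum, dotProduct_sum, signChar_sum,
      mul_sum]
    refine Fintype.sum_equiv (Equiv.addLeft fun _ => x) _ _ fun s => prod_congr rfl fun j _ => ?_
    simp only [Equiv.coe_addLeft, Pi.add_apply, dotProduct_add, AddChar.map_add_eq_mul]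
    rw [dotProduct_comm x]
    linear_combination -(signChar (ξ j ⬝ᵥ s j) * (φ (x + s j) : ℤ)) * hsq (ξ j ⬝ᵥ x)
  simp only [deck, Nat.cast_sum, Nat.cast_prod, mul_sum]
  rw [sum_comm]
  simp only [key, ← sum_mul, sum_signChar_dotProduct]

theorem eq_of_sum_signChar_mul_eq {n i : ℕ} {u v : (Fin i → Fin n → ZMod 2) → ℕ}
    (h : ∀ ξ : Fin i → Fin n → ZMod 2, ∑ s, (∏ j, signChar (ξ j ⬝ᵥ s j)) * (u s : ℤ) =
      ∑ s, (∏ j, signChar (ξ j ⬝ᵥ s j)) * (v s : ℤ)) : u = v := by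
  have inversion : ∀ (w : (Fin i → Fin n → ZMod 2) → ℕ) (t : Fin i → Fin n → ZMod 2),
      ∑ ξ : Fin i → Fin n → ZMod 2, (∏ j, signChar (ξ j ⬝ᵥ -t j)) *
        ∑ s, (∏ j, signChar (ξ j ⬝ᵥ s j)) * (w s : ℤ) = (2 ^ n) ^ i * w t := by
    intro w t
    have orth : ∀ s : Fin i → Fin n → ZMod 2,
        ∑ ξ : Fin i → Fin n → ZMod 2, ∏ j, signChar (ξ j ⬝ᵥ (-t j + s j)) =
          if s = t then (2 ^ n) ^ i else 0 := by
      intro s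
      rw [← Fintype.prod_sum fun j (η : Fin n → ZMod 2) => signChar (η ⬝ᵥ (-t j + s j))]
      simp only [sum_signChar_dotProduct]
      split_ifs with hs
      · simp [hs]
      · obtain ⟨j, hj⟩ := Function.ne_iff.mp hs
        refine prod_eq_zero (mem_univ j) (if_neg fun h0 => hj ?_)
        exact (neg_add_eq_zero.mp h0).symm
    simp only [mul_sum, ← mul_assoc, ← prod_mul_distrib, ← AddChar.map_add_eq_mul,
      ← dotProduct_add]
    rw [sum_comm]
    simp only [← sum_mul, orth, ite_mul, zero_mul, sum_ite_eq', mem_univ, if_true]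
  funext t
  have ht := inversion u t
  simp only [h] at ht
  rw [inversion v t] at ht
  exact_mod_cast (mul_left_cancel₀ (by positivity) ht).symm

/-- Two `i`-decks agree iff the products of `i` Fourier coefficients at frequencies summing to
zero agree. -/
theorem deck_eq_deck_iff {n i : ℕ} {φ ψ : (Fin n → ZMod 2) → ℕ} :
    deck i φ = deck i ψ ↔ ∀ ξ : Fin i → Fin n → ZMod 2, ∑ j, ξ j = 0 →
      ∏ j, signFourier φ (ξ j) = ∏ j, signFourier ψ (ξ j) := by
  constructor
  · intro h ξ hξ
    have h₁ := sum_signChar_mul_deck φ ξ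
    rw [h, sum_signChar_mul_deck ψ ξ, if_pos hξ] at h₁
    exact (mul_left_cancel₀ (by positivity) h₁).symm
  · intro h
    refine eq_of_sum_signChar_mul_eq fun ξ => ?_
    rw [sum_signChar_mul_deck, sum_signChar_mul_deck]
    split_ifs with hξ
    · rw [h ξ hξ]
    · simp

theorem signFourier_pushN_mulVecLin {n p : ℕ} (M : Matrix (Fin p) (Fin n) (ZMod 2))
    (φ : (Fin n → ZMod 2) → ℕ) (η : Fin p → ZMod 2) :
    signFourier (pushN M.mulVecLin φ) η = signFourier φ (Matrix.vecMul η M) := by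
  simp only [signFourier, pushN, Nat.cast_sum, mul_sum]
  rw [← sum_fiberwise univ M.mulVecLin]
  refine sum_congr rfl fun x _ => sum_congr rfl fun z hz => ?_
  rw [← (mem_filter.mp hz).2, Matrix.mulVecLin_apply, Matrix.dotProduct_mulVec]

/-- Any `m + 1` vectors summing to zero are the image, under a linear map from `𝔽₂^p` with
`m ≤ p`, of `m + 1` vectors summing to zero. -/
theorem exists_vecMul_eq_of_sum_eq_zero {n m p : ℕ} (hmp : m ≤ p)
    (ξ : Fin (m + 1) → Fin n → ZMod 2) (hξ : ∑ j, ξ j = 0) :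
    ∃ (M : Matrix (Fin p) (Fin n) (ZMod 2)) (η : Fin (m + 1) → Fin p → ZMod 2),
      ∑ j, η j = 0 ∧ ∀ j, Matrix.vecMul (η j) M = ξ j := by
  let M : Matrix (Fin p) (Fin n) (ZMod 2) :=
    Matrix.of fun l => if h : (l : ℕ) < m then ξ (Fin.castSucc ⟨l, h⟩) else 0
  let e : Fin m → Fin p → ZMod 2 := fun j => Pi.single (Fin.castLE hmp j) 1
  have he : ∀ j, Matrix.vecMul (e j) M = ξ j.castSucc := by
    intro j
    ext l
    simp [e, M]
    rfl
  refine ⟨M, Fin.snoc e (-∑ j, e j), ?_, fun j => ?_⟩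
  · simp [Fin.sum_univ_castSucc]
  · induction j using Fin.lastCases with
    | last =>
      rw [Fin.sum_univ_castSucc] at hξ
      rw [Fin.snoc_last, Matrix.neg_vecMul, Matrix.sum_vecMul, neg_eq_iff_add_eq_zero.mpr]
      simpa only [he] using hξ
    | cast j => rw [Fin.snoc_castSucc, he]

/-- If multisets `f` and `g` from `𝔽₂^n` are `k`-distinguishable (`k ≥ 2`), then there
is an `𝔽₂`-linear map `θ : 𝔽₂^n → 𝔽₂^(k-1)` such that `θf` and `θg` are
`k`-distinguishable. -/
theorem stmt9 {n : ℕ} (k : ℕ) (hk : 2 ≤ k) (f g : (Fin n → ZMod 2) → ℕ)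
    (hfg : ¬ Indist k f g) :
    ∃ θ : (Fin n → ZMod 2) →ₗ[ZMod 2] (Fin (k - 1) → ZMod 2),
      ¬ Indist k (pushN θ f) (pushN θ g) := by
  obtain ⟨i, hi, hdeck⟩ : ∃ i ≤ k, deck i f ≠ deck i g := by simpa [Indist] using hfg
  obtain ⟨ξ, hξ, hne⟩ : ∃ ξ : Fin i → Fin n → ZMod 2, ∑ j, ξ j = 0 ∧
      ∏ j, signFourier f (ξ j) ≠ ∏ j, signFourier g (ξ j) := by
    simpa [deck_eq_deck_iff] using hdeck
  cases i with
  | zero => simp at hne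
  | succ m =>
    obtain ⟨M, η, hη, hM⟩ :=
      exists_vecMul_eq_of_sum_eq_zero (p := k - 1) (by omega : m ≤ k - 1) ξ hξ
    refine ⟨M.mulVecLin, fun h => hne ?_⟩
    simpa only [signFourier_pushN_mulVecLin, hM] using deck_eq_deck_iff.mp (h _ hi) η hη
end

section
/- Let k ≥ 3, let a, b be distinct non-negative integers, and let a₁, …, a_{k−1} be positive integers. Then the standard multisets f_{(a,b),(a₁,…,a_{k−1})} and f_{(b,a),(a₁,…,a_{k−1})} on 𝔽₂^{k−1} have distinguishing number exactly k: they are (k−1)-indistinguishable but k-distinguishable. -/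
open Finset

/-- The standard multiset `f_{(a,b),(a₁,…,a_m)} : 𝔽₂^m → ℕ`, taking value
`a + ∑ aᵢxᵢ` when `∑ xᵢ` is even and `b + ∑ aᵢxᵢ` when `∑ xᵢ` is odd. -/
def stdM {m : ℕ} (a b : ℕ) (c : Fin m → ℕ) : (Fin m → ZMod 2) → ℕ :=
  fun x => (if (∑ i, x i) = 0 then a else b) + ∑ i, c i * (x i).val

/-- The nontrivial rational character of `ZMod 2`. -/
def zmodTwoSign : AddChar (ZMod 2) ℚ where
  toFun z := if z = 0 then 1 else -1
  map_zero_eq_one' := by simp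
  map_add_eq_mul' x y := by
    fin_cases x <;> fin_cases y <;> simp +decide

theorem zmodTwoSign_apply (z : ZMod 2) : zmodTwoSign z = if z = 0 then 1 else -1 := rfl

theorem zmodTwoSign_one : zmodTwoSign 1 = -1 := by simp [zmodTwoSign_apply]

theorem zmodTwoSign_mul_self (z : ZMod 2) : zmodTwoSign z * zmodTwoSign z = 1 := by
  rw [zmodTwoSign_apply]; split_ifs <;> norm_num

theorem val_eq_zmodTwoSign (z : ZMod 2) : ((z.val : ℕ) : ℚ) = (1 - zmodTwoSign z) / 2 := by
  rw [zmodTwoSign_apply]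
  obtain rfl | rfl : z = 0 ∨ z = 1 := by decide +revert
  · simp
  · norm_num [ZMod.val_one]

/-- The `i`-th coordinate character of `𝔽₂^m`. -/
def coordSign {m : ℕ} (i : Fin m) : AddChar (Fin m → ZMod 2) ℚ :=
  zmodTwoSign.compAddMonoidHom (Pi.evalAddMonoidHom _ i)

/-- The parity character of `𝔽₂^m`. -/
def paritySign (m : ℕ) : AddChar (Fin m → ZMod 2) ℚ :=
  zmodTwoSign.compAddMonoidHom (∑ i, Pi.evalAddMonoidHom _ i)

theorem coordSign_apply {m : ℕ} (i : Fin m) (x : Fin m → ZMod 2) :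
    coordSign i x = zmodTwoSign (x i) := rfl

theorem paritySign_apply {m : ℕ} (x : Fin m → ZMod 2) :
    paritySign m x = zmodTwoSign (∑ i, x i) := by
  simp [paritySign]

theorem paritySign_eq_prod {m : ℕ} (x : Fin m → ZMod 2) :
    paritySign m x = ∏ i, coordSign i x := by
  rw [paritySign_apply]
  exact map_prod zmodTwoSign.toMonoidHom (fun i => Multiplicative.ofAdd (x i)) univ

theorem paritySign_mul_self {m : ℕ} (x : Fin m → ZMod 2) :
    paritySign m x * paritySign m x = 1 := by
  rw [paritySign_apply, zmodTwoSign_mul_self]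

theorem coordSign_single_self {m : ℕ} (i : Fin m) : coordSign i (Pi.single i 1) = -1 := by
  rw [coordSign_apply, Pi.single_eq_same, zmodTwoSign_one]

theorem coordSign_single_of_ne {m : ℕ} {i l : Fin m} (h : i ≠ l) :
    coordSign i (Pi.single l 1) = 1 := by
  rw [coordSign_apply, Pi.single_eq_of_ne h, AddChar.map_zero_eq_one]

theorem paritySign_single {m : ℕ} (i : Fin m) : paritySign m (Pi.single i 1) = -1 := by
  rw [paritySign_apply, sum_pi_single' i (1 : ZMod 2) univ, if_pos (mem_univ i), zmodTwoSign_one]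

theorem sum_eq_zero_of_add_eq_neg {G : Type*} [Fintype G] [AddCommGroup G] (h : G → ℚ) (d : G)
    (hd : ∀ x, h (x + d) = -h x) : ∑ x, h x = 0 := by
  have h₁ : ∑ x, h (x + d) = ∑ x, h x := Equiv.sum_comp (Equiv.addRight d) h
  simp only [hd, sum_neg_distrib] at h₁
  linarith

theorem stdM_cast {m : ℕ} (a b : ℕ) (c : Fin m → ℕ) (x : Fin m → ZMod 2) :
    (stdM a b c x : ℚ) = ((a : ℚ) - b) / 2 * paritySign m x +
      (((a : ℚ) + b) / 2 + ∑ i, (c i : ℚ) * ((x i).val : ℚ)) := by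
  rw [paritySign_apply, zmodTwoSign_apply, stdM]
  push_cast
  split_ifs <;> ring

/-- The parity character is orthogonal to every product of fewer than `m` functions each of which
is a sum of functions of a single coordinate. -/
theorem sum_paritySign_mul_prod_eq_zero {m : ℕ} {ι : Type*} (S : Finset ι)
    (hS : #S < m) (h : ι → Fin m → ZMod 2 → ℚ) :
    ∑ g : Fin m → ZMod 2, paritySign m g * ∏ j ∈ S, ∑ i, h j i (g i) = 0 := by
  classical
  simp only [prod_sum, mul_sum]
  rw [sum_comm]
  refine sum_eq_zero fun p _ => ?_
  obtain ⟨l, hl⟩ : ∃ l : Fin m, ∀ j : S, p j j.2 ≠ l := by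
    by_contra! H
    have := Fintype.card_le_of_surjective (fun j : S => p j j.2) H
    simp at this
    omega
  refine sum_eq_zero_of_add_eq_neg _ (Pi.single l 1) fun x => ?_
  rw [AddChar.map_add_eq_mul, paritySign_single]
  have : ∀ j : S, (x + Pi.single l 1 : Fin m → ZMod 2) (p j j.2) = x (p j j.2) := fun j => by
    simp [Pi.single_eq_of_ne (hl j)]
  simp only [this]
  ring

theorem affine_eq_sum {m : ℕ} (hm : 0 < m) (A : ℚ) (c : Fin m → ℚ) (x s : Fin m → ZMod 2) :
    A + ∑ i, c i * (((x + s) i).val : ℚ) =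
      ∑ i, (A / m + c i * ((x i + s i).val : ℚ)) := by
  have : (m : ℚ) ≠ 0 := by positivity
  simp [sum_add_distrib]
  field_simp

theorem deck_stdM_cast {m : ℕ} (a b n : ℕ) (c : Fin m → ℕ) (s : Fin n → Fin m → ZMod 2) :
    (deck n (stdM a b c) s : ℚ) = ∑ T : Finset (Fin n),
      (((a : ℚ) - b) / 2) ^ #T * (∏ j ∈ T, paritySign m (s j)) *
      ∑ g, paritySign m g ^ #T *
        ∏ j ∈ univ \ T, (((a : ℚ) + b) / 2 + ∑ i, (c i : ℚ) * (((g + s j) i).val : ℚ)) := by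
  rw [deck]
  push_cast
  simp only [stdM_cast, prod_add, powerset_univ]
  rw [sum_comm]
  refine sum_congr rfl fun T _ => ?_
  rw [mul_sum]
  refine sum_congr rfl fun g _ => ?_
  simp only [AddChar.map_add_eq_mul, prod_mul_distrib, prod_const]
  ring

theorem indist_stdM_swap {m : ℕ} (hm : 0 < m) (a b : ℕ) (c : Fin m → ℕ) :
    Indist m (stdM a b c) (stdM b a c) := by
  intro n hn
  funext s
  rw [← Nat.cast_inj (R := ℚ), deck_stdM_cast, deck_stdM_cast]
  refine sum_congr rfl fun T _ => ?_
  rw [add_comm (b : ℚ) a]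
  rcases Nat.even_or_odd #T with hT | hT
  · rw [show ((b : ℚ) - a) / 2 = -(((a : ℚ) - b) / 2) by ring, hT.neg_pow]
  · have hpow : ∀ g, paritySign m g ^ #T = paritySign m g := fun g => by
      obtain ⟨r, hr⟩ := hT
      rw [hr, pow_succ, pow_mul, sq, paritySign_mul_self, one_pow, one_mul]
    have hcard : #(univ \ T) < m := by
      have h₁ := hT.pos
      have h₂ := card_le_univ T
      rw [card_univ_sdiff]
      simp only [Fintype.card_fin] at h₂ ⊢
      omega
    simp only [hpow, affine_eq_sum hm]
    rw [sum_paritySign_mul_prod_eq_zero (univ \ T) hcard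
      (fun j i z => ((a : ℚ) + b) / 2 / m + (c i : ℚ) * ((z + s j i).val : ℚ)), mul_zero, mul_zero]

/-- The Fourier coefficients of the `k`-deck along characters with trivial product. -/
theorem sum_deck_mul_prod {G : Type*} [Fintype G] [AddCommGroup G] (k : ℕ) (φ : G → ℕ)
    (ψ : Fin k → AddChar G ℚ) (hψ : ∀ g, ∏ j, ψ j g = 1) :
    ∑ s, (deck k φ s : ℚ) * ∏ j, ψ j (s j) =
      Fintype.card G * ∏ j, ∑ x, (φ x : ℚ) * ψ j x := by
  classical
  simp only [deck, Nat.cast_sum, Nat.cast_prod, sum_mul]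
  rw [sum_comm, ← nsmul_eq_mul, ← card_univ, ← sum_const]
  refine sum_congr rfl fun g _ => ?_
  rw [prod_univ_sum, Fintype.piFinset_univ]
  refine Eq.trans ?_ (Equiv.sum_comp (Equiv.addLeft fun _ => g) _)
  refine sum_congr rfl fun s _ => ?_
  simp only [Equiv.coe_addLeft, Pi.add_apply, AddChar.map_add_eq_mul, prod_mul_distrib, hψ,
    one_mul]

theorem stdM_cast_eq_coordSign {m : ℕ} (a b : ℕ) (c : Fin m → ℕ) (x : Fin m → ZMod 2) :
    (stdM a b c x : ℚ) = ((a : ℚ) - b) / 2 * paritySign m x +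
      ((((a : ℚ) + b) / 2 + ∑ i, (c i : ℚ) / 2) - ∑ i, (c i : ℚ) / 2 * coordSign i x) := by
  rw [stdM_cast, add_sub_assoc, ← sum_sub_distrib]
  congr 2
  refine sum_congr rfl fun i _ => ?_
  rw [val_eq_zmodTwoSign, coordSign_apply]
  ring

theorem sum_paritySign {m : ℕ} (hm : 0 < m) : ∑ x, paritySign m x = 0 :=
  sum_eq_zero_of_add_eq_neg _ (Pi.single ⟨0, hm⟩ 1) fun x => by
    rw [AddChar.map_add_eq_mul, paritySign_single]; ring

theorem sum_coordSign {m : ℕ} (i : Fin m) : ∑ x, coordSign i x = 0 :=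
  sum_eq_zero_of_add_eq_neg _ (Pi.single i 1) fun x => by
    rw [AddChar.map_add_eq_mul, coordSign_single_self]; ring

theorem sum_coordSign_mul_paritySign {m : ℕ} (hm : 2 ≤ m) (i : Fin m) :
    ∑ x, coordSign i x * paritySign m x = 0 := by
  have : Nontrivial (Fin m) := Fin.nontrivial_iff_two_le.mpr hm
  obtain ⟨l, hl⟩ := exists_ne i
  refine sum_eq_zero_of_add_eq_neg _ (Pi.single l 1) fun x => ?_
  rw [AddChar.map_add_eq_mul, AddChar.map_add_eq_mul, paritySign_single,
    coordSign_single_of_ne hl.symm]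
  ring

theorem sum_coordSign_mul_coordSign {m : ℕ} (i l : Fin m) :
    ∑ x, coordSign i x * coordSign l x =
      if i = l then (Fintype.card (Fin m → ZMod 2) : ℚ) else 0 := by
  split_ifs with h
  · subst h
    simp [coordSign_apply, zmodTwoSign_mul_self]
  · refine sum_eq_zero_of_add_eq_neg _ (Pi.single l 1) fun x => ?_
    rw [AddChar.map_add_eq_mul, AddChar.map_add_eq_mul, coordSign_single_self,
      coordSign_single_of_ne h]
    ring

theorem sum_stdM_mul_paritySign {m : ℕ} (hm : 2 ≤ m) (a b : ℕ) (c : Fin m → ℕ) :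
    ∑ x, (stdM a b c x : ℚ) * paritySign m x =
      Fintype.card (Fin m → ZMod 2) * (((a : ℚ) - b) / 2) := by
  simp only [stdM_cast_eq_coordSign, add_mul, sub_mul, sum_mul, mul_assoc, paritySign_mul_self,
    sum_add_distrib, sum_sub_distrib]
  rw [sum_comm (f := fun x i => (c i : ℚ) / 2 * (coordSign i x * paritySign m x)),
    sum_comm (f := fun x i => (c i : ℚ) / 2 * paritySign m x)]
  simp only [← mul_sum, sum_coordSign_mul_paritySign hm, sum_paritySign (m := m) (by omega)]
  simp [mul_comm]

theorem sum_stdM_mul_coordSign {m : ℕ} (hm : 2 ≤ m) (a b : ℕ) (c : Fin m → ℕ) (l : Fin m) :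
    ∑ x, (stdM a b c x : ℚ) * coordSign l x =
      -(Fintype.card (Fin m → ZMod 2) * ((c l : ℚ) / 2)) := by
  simp only [stdM_cast_eq_coordSign, add_mul, sub_mul, sum_mul, mul_assoc,
    sum_add_distrib, sum_sub_distrib]
  rw [sum_comm (f := fun x i => (c i : ℚ) / 2 * (coordSign i x * coordSign l x)),
    sum_comm (f := fun x i => (c i : ℚ) / 2 * coordSign l x)]
  simp only [← mul_sum, mul_comm (paritySign m _), sum_coordSign_mul_paritySign hm,
    sum_coordSign, sum_coordSign_mul_coordSign]
  simp [mul_comm]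

theorem deck_stdM_swap_ne {m : ℕ} (hm : 2 ≤ m) (a b : ℕ) (hab : a ≠ b) (c : Fin m → ℕ)
    (hc : ∀ i, 0 < c i) : deck (m + 1) (stdM a b c) ≠ deck (m + 1) (stdM b a c) := by
  intro h
  let ψ : Fin (m + 1) → AddChar (Fin m → ZMod 2) ℚ := Fin.cons (paritySign m) coordSign
  have hψ : ∀ g, ∏ j, ψ j g = 1 := fun g => by
    simp only [ψ, Fin.prod_univ_succ, Fin.cons_zero, Fin.cons_succ]
    rw [← paritySign_eq_prod, paritySign_mul_self]
  have h₁ := sum_deck_mul_prod (m + 1) (stdM a b c) ψ hψ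
  rw [h, sum_deck_mul_prod (m + 1) (stdM b a c) ψ hψ] at h₁
  simp only [ψ, Fin.prod_univ_succ, Fin.cons_zero, Fin.cons_succ, sum_stdM_mul_paritySign hm,
    sum_stdM_mul_coordSign hm] at h₁
  have hcard : (Fintype.card (Fin m → ZMod 2) : ℚ) ≠ 0 := Nat.cast_ne_zero.mpr Fintype.card_ne_zero
  have hprod : ∏ i, -((Fintype.card (Fin m → ZMod 2) : ℚ) * ((c i : ℚ) / 2)) ≠ 0 :=
    prod_ne_zero_iff.mpr fun i _ => neg_ne_zero.mpr <| mul_ne_zero hcard <|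
      div_ne_zero (Nat.cast_ne_zero.mpr (hc i).ne') two_ne_zero
  have h₂ := mul_left_cancel₀ hcard (mul_right_cancel₀ hprod (mul_left_cancel₀ hcard h₁))
  exact hab (by exact_mod_cast (by linarith : (a : ℚ) = b))

/-- For `k ≥ 3`, distinct non-negative integers `a ≠ b` and positive integers
`a₁,…,a_{k-1}`, the standard multisets `f_{(a,b),(a₁,…,a_{k-1})}` and
`f_{(b,a),(a₁,…,a_{k-1})}` on `𝔽₂^(k-1)` have distinguishing number exactly `k`:
they are `(k-1)`-indistinguishable but `k`-distinguishable. -/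
theorem stmt11 (k : ℕ) (hk : 3 ≤ k) (a b : ℕ) (hab : a ≠ b)
    (c : Fin (k - 1) → ℕ) (hc : ∀ i, 0 < c i) :
    Indist (k - 1) (stdM a b c) (stdM b a c) ∧
    ¬ Indist k (stdM a b c) (stdM b a c) := by
  obtain ⟨m, rfl⟩ : ∃ m, k = m + 1 := ⟨k - 1, by omega⟩
  exact ⟨indist_stdM_swap (m := m) (by omega) a b c,
    fun h => deck_stdM_swap_ne (m := m) (by omega) a b hab c hc (h _ le_rfl)⟩
end

section
/- Let n and k be positive integers. If the reconstruction number of 𝔽₂^n is at least k — that is, if there exist subsets S₁, S₂ ⊆ 𝔽₂^n which are (k−1)-indistinguishable but are not translates of one another — then 2^{n+1−k} ≥ k (as a real inequality, allowing negative exponent). -/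
open Finset

/-- The nontrivial sign character of `ZMod 2`. -/
def sgn (a : ZMod 2) : ℤ := if a = 0 then 1 else -1

lemma sgn_add : ∀ a b : ZMod 2, sgn (a + b) = sgn a * sgn b := by decide

lemma sgn_eq_or (a : ZMod 2) : sgn a = 1 ∨ sgn a = -1 := by
  unfold sgn; split_ifs <;> simp

/-- The character of `𝔽₂^n` indexed by `u`, with values in `{1, -1}`. -/
def chi {n : ℕ} (u x : Fin n → ZMod 2) : ℤ := sgn (u ⬝ᵥ x)

/-- The Fourier transform of a natural-valued function on `𝔽₂^n`. -/
def ft {n : ℕ} (φ : (Fin n → ZMod 2) → ℕ) (u : Fin n → ZMod 2) : ℤ :=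
  ∑ x, (φ x : ℤ) * chi u x

section Fourier

variable {n : ℕ}

lemma add_self_eq_zero_vec (u : Fin n → ZMod 2) : u + u = 0 :=
  funext fun _ => CharTwo.add_self_eq_zero _

lemma neg_eq_vec (u : Fin n → ZMod 2) : -u = u :=
  neg_eq_of_add_eq_zero_left (add_self_eq_zero_vec u)

lemma add_eq_zero_iff_vec (u v : Fin n → ZMod 2) : u + v = 0 ↔ u = v := by
  rw [add_eq_zero_iff_eq_neg, neg_eq_vec]

lemma chi_comm (u x : Fin n → ZMod 2) : chi u x = chi x u := by
  rw [chi, chi, dotProduct_comm]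

lemma chi_zero_left (x : Fin n → ZMod 2) : chi 0 x = 1 := by simp [chi, sgn]

lemma chi_add_left (u v x : Fin n → ZMod 2) : chi (u + v) x = chi u x * chi v x := by
  rw [chi, add_dotProduct, sgn_add]; rfl

lemma chi_add_right (u x y : Fin n → ZMod 2) : chi u (x + y) = chi u x * chi u y := by
  rw [chi, dotProduct_add, sgn_add]; rfl

lemma chi_eq_or (u x : Fin n → ZMod 2) : chi u x = 1 ∨ chi u x = -1 := sgn_eq_or _

lemma chi_mul_self (u x : Fin n → ZMod 2) : chi u x * chi u x = 1 := by
  rcases chi_eq_or u x with h | h <;> simp [h]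

lemma chi_sum {ι : Type*} (A : Finset ι) (v : ι → Fin n → ZMod 2) (x : Fin n → ZMod 2) :
    chi (∑ i ∈ A, v i) x = ∏ i ∈ A, chi (v i) x := by
  classical
  induction A using Finset.induction_on with
  | empty => simp [chi_zero_left]
  | insert a s ha ih => rw [sum_insert ha, prod_insert ha, chi_add_left, ih]

lemma sum_chi (u : Fin n → ZMod 2) : ∑ x, chi u x = if u = 0 then 2 ^ n else 0 := by
  split_ifs with h
  · subst h
    simp [chi_zero_left, ZMod.card]
  · obtain ⟨i, hi⟩ := Function.ne_iff.mp h
    have hflip : chi u (Pi.single i 1) = -1 := by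
      simp only [chi, dotProduct_single, mul_one, sgn]
      exact if_neg hi
    have hsum := Equiv.sum_comp (Equiv.addRight (Pi.single i (1 : ZMod 2))) (chi u)
    simp only [Equiv.coe_addRight, chi_add_right, hflip, mul_neg, mul_one,
      sum_neg_distrib] at hsum
    linarith

lemma ft_inversion (φ : (Fin n → ZMod 2) → ℕ) (x : Fin n → ZMod 2) :
    ∑ u, ft φ u * chi u x = 2 ^ n * φ x := by
  simp only [ft, sum_mul]
  rw [sum_comm]
  have h (y : Fin n → ZMod 2) :
      ∑ u, (φ y : ℤ) * chi u y * chi u x = if y = x then 2 ^ n * (φ x : ℤ) else 0 := by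
    have h1 : ∀ u, (φ y : ℤ) * chi u y * chi u x = φ y * chi (y + x) u := fun u => by
      rw [mul_assoc, ← chi_add_right, chi_comm]
    simp only [h1, ← mul_sum, sum_chi, add_eq_zero_iff_vec]
    split_ifs with hyx
    · subst hyx; ring
    · simp
  simp [h]

lemma sum_shift_chi (φ : (Fin n → ZMod 2) → ℕ) (u g : Fin n → ZMod 2) :
    ∑ t, (φ (g + t) : ℤ) * chi u t = chi u g * ft φ u := by
  rw [ft, mul_sum, ← Equiv.sum_comp (Equiv.addLeft g) fun x => chi u g * (φ x * chi u x)]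
  refine sum_congr rfl fun t _ => ?_
  rw [Equiv.coe_addLeft, chi_add_right]
  linear_combination (-(φ (g + t) : ℤ) * chi u t) * chi_mul_self u g

/-- Products of Fourier coefficients along a relation are determined by the deck. -/
lemma sum_deck_mul_chi (k : ℕ) (φ : (Fin n → ZMod 2) → ℕ) (v : Fin k → Fin n → ZMod 2)
    (hv : ∑ j, v j = 0) :
    ∑ s, (deck k φ s : ℤ) * ∏ j, chi (v j) (s j) = 2 ^ n * ∏ j, ft φ (v j) := by
  have h (g : Fin n → ZMod 2) :
      ∑ s : Fin k → Fin n → ZMod 2, ∏ j, ((φ (g + s j) : ℤ) * chi (v j) (s j)) =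
        ∏ j, ft φ (v j) := by
    have hp := Fintype.prod_sum
      (fun (j : Fin k) (t : Fin n → ZMod 2) => (φ (g + t) : ℤ) * chi (v j) t)
    rw [← hp]
    simp only [sum_shift_chi, prod_mul_distrib]
    rw [← chi_sum, hv, chi_zero_left, one_mul]
  simp only [deck, Nat.cast_sum, Nat.cast_prod, sum_mul, ← prod_mul_distrib]
  rw [sum_comm]
  simp only [h, sum_const, card_univ, Fintype.card_pi, ZMod.card, prod_const, Fintype.card_fin,
    nsmul_eq_mul, Nat.cast_pow, Nat.cast_ofNat]

lemma Indist.prod_ft_eq {m i : ℕ} {φ ψ : (Fin n → ZMod 2) → ℕ} (h : Indist m φ ψ) (hi : i ≤ m)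
    (v : Fin i → Fin n → ZMod 2) (hv : ∑ j, v j = 0) :
    ∏ j, ft φ (v j) = ∏ j, ft ψ (v j) := by
  have h1 := sum_deck_mul_chi i φ v hv
  rw [h i hi, sum_deck_mul_chi i ψ v hv] at h1
  exact (mul_left_cancel₀ (by positivity) h1).symm

lemma Indist.prod_finset_ft_eq {m : ℕ} {φ ψ : (Fin n → ZMod 2) → ℕ} (h : Indist m φ ψ)
    (C : Finset (Fin n → ZMod 2)) (hC : #C ≤ m) (hs : ∑ u ∈ C, u = 0) :
    ∏ u ∈ C, ft φ u = ∏ u ∈ C, ft ψ u := by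
  have key (M : Type) [CommMonoid M] (f : (Fin n → ZMod 2) → M) :
      ∏ j, f (C.equivFin.symm j) = ∏ u ∈ C, f u := by
    rw [Equiv.prod_comp C.equivFin.symm (fun u : C => f u), prod_coe_sort C f]
  have key' : ∑ j, (C.equivFin.symm j : Fin n → ZMod 2) = 0 := by
    rw [Equiv.sum_comp C.equivFin.symm (fun u : C => (u : Fin n → ZMod 2)),
      sum_coe_sort C (fun u => u), hs]
  have := h.prod_ft_eq hC (fun j => (C.equivFin.symm j : Fin n → ZMod 2)) key'
  rwa [key ℤ (ft φ), key ℤ (ft ψ)] at this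

lemma Indist.ft_sq_eq {m : ℕ} {φ ψ : (Fin n → ZMod 2) → ℕ} (h : Indist m φ ψ) (hm : 2 ≤ m)
    (u : Fin n → ZMod 2) : ft φ u ^ 2 = ft ψ u ^ 2 := by
  have := h.prod_ft_eq hm ![u, u] (by simp [add_self_eq_zero_vec])
  simpa [Fin.prod_univ_two, sq] using this

/-- A sign pattern respecting every linear relation in `T` is induced by a character. -/
lemma exists_chi_eq (T : Finset (Fin n → ZMod 2)) (e : (Fin n → ZMod 2) → ZMod 2)
    (h : ∀ C ⊆ T, ∑ u ∈ C, u = 0 → ∑ u ∈ C, e u = 0) :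
    ∃ z : Fin n → ZMod 2, ∀ u ∈ T, e u = u ⬝ᵥ z := by
  classical
  let L : (T → ZMod 2) →ₗ[ZMod 2] (Fin n → ZMod 2) :=
    Fintype.linearCombination (ZMod 2) (fun u : T => (u : Fin n → ZMod 2))
  let E : (T → ZMod 2) →ₗ[ZMod 2] ZMod 2 :=
    Fintype.linearCombination (ZMod 2) (fun u : T => e u)
  have hE : E ∈ L.ker.dualAnnihilator := by
    rw [Submodule.mem_dualAnnihilator]
    intro c hc
    have key (M : Type) [AddCommGroup M] [Module (ZMod 2) M] (f : (Fin n → ZMod 2) → M) :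
        ∑ u : T, c u • f u = ∑ u ∈ (univ.filter fun u : T => c u = 1).map
          (Function.Embedding.subtype _), f u := by
      rw [sum_map, sum_filter]
      refine sum_congr rfl fun u _ => ?_
      have h01 : ∀ a : ZMod 2, a = 0 ∨ a = 1 := by decide
      rcases h01 (c u) with h | h <;> simp [h]
    have hc' : ∑ u : T, c u • (u : Fin n → ZMod 2) = 0 := by
      simpa [L, Fintype.linearCombination_apply] using hc
    change E c = 0
    rw [Fintype.linearCombination_apply, key (ZMod 2) e]
    refine h _ (fun u hu => ?_) ?_
    · obtain ⟨w, -, rfl⟩ := mem_map.mp hu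
      exact w.2
    · rw [← key (Fin n → ZMod 2) (fun u => u), hc']
  rw [← LinearMap.range_dualMap_eq_dualAnnihilator_ker] at hE
  obtain ⟨ζ, hζ⟩ := hE
  refine ⟨fun i => ζ (Pi.single i 1), fun u hu => ?_⟩
  have h1 := LinearMap.congr_fun hζ (Pi.single ⟨u, hu⟩ 1)
  have hL : L (Pi.single ⟨u, hu⟩ 1) = u := by
    simp [L, Fintype.linearCombination_apply_single]
  have hE' : E (Pi.single ⟨u, hu⟩ 1) = e u := by
    simp [E, Fintype.linearCombination_apply_single]
  rw [LinearMap.dualMap_apply, hL, hE'] at h1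
  rw [← h1, LinearMap.pi_apply_eq_sum_univ ζ u]
  refine sum_congr rfl fun i _ => ?_
  rw [smul_eq_mul]
  congr 2
  ext j
  simp [Pi.single_apply, eq_comm]

/-- Expansion of a Riesz product against `φ`. -/
lemma sum_mul_prod_one_add (φ : (Fin n → ZMod 2) → ℕ) (C : Finset (Fin n → ZMod 2))
    (η : (Fin n → ZMod 2) → ℤ) :
    ∑ y, (φ y : ℤ) * ∏ u ∈ C, (1 + η u * chi u y) =
      ∑ A ∈ C.powerset, (∏ u ∈ A, η u) * ft φ (∑ u ∈ A, u) := by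
  simp only [prod_one_add, mul_sum, ft]
  rw [sum_comm]
  refine sum_congr rfl fun A _ => sum_congr rfl fun y _ => ?_
  rw [chi_sum A (fun u => u), prod_mul_distrib]
  ring

/-- A sum over the subsets of `C` only involving sizes `0`, `1`, `#C - 1` and `#C`. -/
lemma sum_powerset_of_middle_eq_zero {α : Type*} [DecidableEq α] (C : Finset α) (hC : 3 ≤ #C)
    (F : Finset α → ℤ) (hF : ∀ A ⊆ C, 2 ≤ #A → #A + 2 ≤ #C → F A = 0) :
    ∑ A ∈ C.powerset, F A = F ∅ + F C + ∑ u ∈ C, (F {u} + F (C.erase u)) := by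
  obtain ⟨s, hs⟩ : ∃ s, #C = s + 3 := ⟨#C - 3, by omega⟩
  have herase : powersetCard (s + 2) C = C.image C.erase := by
    ext A
    simp only [mem_powersetCard, mem_image]
    constructor
    · rintro ⟨hA, hcard⟩
      have h1 : #(C \ A) = 1 := by rw [card_sdiff_of_subset hA]; omega
      obtain ⟨u, hu⟩ := card_eq_one.mp h1
      have huC : u ∈ C \ A := by simp [hu]
      refine ⟨u, (mem_sdiff.mp huC).1, ?_⟩
      rw [← sdiff_singleton_eq_erase, ← hu, Finset.sdiff_sdiff_eq_self hA]
    · rintro ⟨u, hu, rfl⟩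
      exact ⟨erase_subset _ _, by rw [card_erase_of_mem hu]; omega⟩
  have hmid : ∑ j ∈ range (s + 1), ∑ A ∈ powersetCard (j + 1 + 1) C, F A =
      ∑ A ∈ powersetCard (s + 2) C, F A := by
    rw [sum_range_succ, add_eq_right]
    refine sum_eq_zero fun j hj => sum_eq_zero fun A hA => ?_
    obtain ⟨hA, hcard⟩ := mem_powersetCard.mp hA
    have := mem_range.mp hj
    exact hF A hA (by omega) (by omega)
  have htop : powersetCard (s + 3) C = {C} := by rw [← hs, powersetCard_self]
  rw [sum_powerset, hs, sum_range_succ, sum_range_succ', sum_range_succ', hmid, htop, herase,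
    sum_image fun u hu v hv h => C.erase_injOn hu hv h, zero_add, powersetCard_one,
    powersetCard_zero, sum_map, sum_singleton, sum_singleton, sum_add_distrib]
  simp only [Function.Embedding.coeFn_mk]
  ring

lemma riesz_eq (φ : (Fin n → ZMod 2) → ℕ) (C : Finset (Fin n → ZMod 2)) (hC : 3 ≤ #C)
    (hsum : ∑ u ∈ C, u = 0)
    (hmid : ∀ A ⊆ C, 2 ≤ #A → #A + 2 ≤ #C → ft φ (∑ u ∈ A, u) = 0)
    (η : (Fin n → ZMod 2) → ℤ) (hη : ∀ u, η u = 1 ∨ η u = -1) (hprod : ∏ u ∈ C, η u = 1) :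
    ∑ y, (φ y : ℤ) * ∏ u ∈ C, (1 + η u * chi u y) = 2 * (ft φ 0 + ∑ u ∈ C, ft φ u * η u) := by
  rw [sum_mul_prod_one_add, sum_powerset_of_middle_eq_zero C hC _
    fun A hA h2 hr => by rw [hmid A hA h2 hr, mul_zero]]
  have h (u) (hu : u ∈ C) : (∏ v ∈ {u}, η v) * ft φ (∑ v ∈ {u}, v) +
      (∏ v ∈ C.erase u, η v) * ft φ (∑ v ∈ C.erase u, v) = 2 * (ft φ u * η u) := by
    have h1 : ∑ v ∈ C.erase u, v = u := by
      rw [← add_eq_zero_iff_vec, sum_erase_add _ _ hu, hsum]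
    have h2 : ∏ v ∈ C.erase u, η v = η u := by
      have := prod_erase_mul C η hu
      rw [hprod] at this
      rcases hη u with h | h <;> rw [h] at this ⊢ <;> linarith
    rw [h1, h2, prod_singleton, sum_singleton]
    ring
  rw [sum_congr rfl h, ← mul_sum, hsum, hprod]
  simp only [prod_empty, sum_empty]
  ring

lemma prod_one_add_eq (C : Finset (Fin n → ZMod 2)) (η : (Fin n → ZMod 2) → ℤ)
    (hη : ∀ u, η u = 1 ∨ η u = -1) (y : Fin n → ZMod 2) :
    ∏ u ∈ C, (1 + η u * chi u y) = 0 ∨ ∏ u ∈ C, (1 + η u * chi u y) = 2 ^ #C := by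
  by_cases h : ∃ u ∈ C, 1 + η u * chi u y = 0
  · obtain ⟨u, hu, h0⟩ := h
    exact Or.inl (prod_eq_zero hu h0)
  · push Not at h
    refine Or.inr (prod_eq_pow_card fun u hu => ?_)
    have := h u hu
    rcases hη u with h1 | h1 <;> rcases chi_eq_or u y with h2 | h2 <;> simp_all

/-- The partial Fourier sum over a circuit `C` has values in `[0, 2 ^ n]`, up to a factor of two,
and is divisible by a large power of two. -/
lemma riesz_dvd_and_bounds (φ : (Fin n → ZMod 2) → ℕ) (hφ : ∀ x, φ x ≤ 1)
    (C : Finset (Fin n → ZMod 2)) (hC : 3 ≤ #C) (hsum : ∑ u ∈ C, u = 0)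
    (hcirc : ∀ A ⊆ C, A.Nonempty → #A < #C → ∑ u ∈ A, u ≠ 0)
    (hmid : ∀ A ⊆ C, 2 ≤ #A → #A + 2 ≤ #C → ft φ (∑ u ∈ A, u) = 0)
    (η : (Fin n → ZMod 2) → ℤ) (hη : ∀ u, η u = 1 ∨ η u = -1) (hprod : ∏ u ∈ C, η u = 1) :
    (2 : ℤ) ^ #C ∣ 2 * (ft φ 0 + ∑ u ∈ C, ft φ u * η u) ∧
      0 ≤ ft φ 0 + ∑ u ∈ C, ft φ u * η u ∧ ft φ 0 + ∑ u ∈ C, ft φ u * η u ≤ 2 ^ n := by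
  have hone : ∀ u, ft (fun _ => 1) u = if u = (0 : Fin n → ZMod 2) then 2 ^ n else 0 := fun u => by
    rw [← sum_chi]; simp [ft]
  have heq := riesz_eq φ C hC hsum hmid η hη hprod
  have htot := riesz_eq (fun _ => 1) C hC hsum
    (fun A hA h2 hr => by
      rw [hone, if_neg (hcirc A hA (card_pos.mp (by omega)) (by omega))]) η hη hprod
  have hzero : ∑ u ∈ C, ft (fun _ => 1) u * η u = 0 := sum_eq_zero fun u hu => by
    have := hcirc {u} (singleton_subset_iff.mpr hu) (singleton_nonempty u) (by simp; omega)
    rw [sum_singleton] at this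
    rw [hone, if_neg this, zero_mul]
  rw [hzero, hone, if_pos rfl] at htot
  have hnonneg : ∀ y, 0 ≤ ∏ u ∈ C, (1 + η u * chi u y) := fun y => by
    rcases prod_one_add_eq C η hη y with h | h <;> rw [h]; positivity
  have hle : ∑ y, (φ y : ℤ) * ∏ u ∈ C, (1 + η u * chi u y) ≤
      ∑ y, ((1 : ℕ) : ℤ) * ∏ u ∈ C, (1 + η u * chi u y) :=
    sum_le_sum fun y _ => mul_le_mul_of_nonneg_right (by exact_mod_cast hφ y) (hnonneg y)
  have hpos : 0 ≤ ∑ y, (φ y : ℤ) * ∏ u ∈ C, (1 + η u * chi u y) :=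
    sum_nonneg fun y _ => mul_nonneg (by positivity) (hnonneg y)
  refine ⟨?_, by linarith, by linarith⟩
  rw [← heq]
  refine dvd_sum fun y _ => Dvd.dvd.mul_left ?_ _
  rcases prod_one_add_eq C η hη y with h | h <;> rw [h]
  exact dvd_zero _

end Fourier

/-- An affine form on the cube with nonzero coefficients and finely divisible values in `[0, N]`
depends on few variables. -/
lemma card_mul_two_pow_le {α : Type*} [DecidableEq α] (C : Finset α) (a₀ N : ℤ) (a : α → ℤ)
    (ha : ∀ u ∈ C, a u ≠ 0)
    (h : ∀ η : α → ℤ, (∀ u, η u = 1 ∨ η u = -1) →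
      (2 : ℤ) ^ #C ∣ 2 * (a₀ + ∑ u ∈ C, a u * η u) ∧
        0 ≤ a₀ + ∑ u ∈ C, a u * η u ∧ a₀ + ∑ u ∈ C, a u * η u ≤ N) :
    #C * (2 : ℤ) ^ #C ≤ 2 * N := by
  have hbig : ∀ u ∈ C, (2 : ℤ) ^ #C ≤ 4 * |a u| := fun u hu => by
    have h1 := (h (fun _ => 1) fun _ => Or.inl rfl).1
    have h2 := (h (fun v => if v = u then -1 else 1) fun v => by split_ifs <;> simp).1
    have hd := dvd_sub h1 h2
    have he : 2 * (a₀ + ∑ v ∈ C, a v * 1) - 2 * (a₀ + ∑ v ∈ C, a v * if v = u then -1 else 1) =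
        4 * a u := by
      rw [← mul_sub, add_sub_add_left_eq_sub, ← sum_sub_distrib, sum_eq_single_of_mem u hu]
      · rw [if_pos rfl]; ring
      · intro v _ hv; rw [if_neg hv]; ring
    rw [he, ← dvd_abs, abs_mul, abs_of_pos (by norm_num : (0 : ℤ) < 4)] at hd
    exact Int.le_of_dvd (by have := abs_pos.mpr (ha u hu); linarith) hd
  have hmax := (h (fun u => if 0 ≤ a u then 1 else -1) fun u => by split_ifs <;> simp).2.2
  have hmin := (h (fun u => if 0 ≤ a u then -1 else 1) fun u => by split_ifs <;> simp).2.1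
  have h1 : ∑ u ∈ C, a u * (if 0 ≤ a u then 1 else -1) = ∑ u ∈ C, |a u| :=
    sum_congr rfl fun u _ => by
      split_ifs with h
      · rw [abs_of_nonneg h, mul_one]
      · rw [abs_of_neg (not_le.mp h), mul_neg_one]
  have h2 : ∑ u ∈ C, a u * (if 0 ≤ a u then -1 else 1) = -∑ u ∈ C, |a u| := by
    rw [← sum_neg_distrib]
    refine sum_congr rfl fun u _ => ?_
    split_ifs with h
    · rw [abs_of_nonneg h, mul_neg_one]
    · rw [abs_of_neg (not_le.mp h), neg_neg, mul_one]
  have h3 := card_nsmul_le_sum C _ _ hbig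
  rw [nsmul_eq_mul, ← mul_sum] at h3
  rw [h1] at hmax
  rw [h2] at hmin
  linarith

section Reconstruction

variable {n : ℕ}

/-- Functions whose Fourier transforms have equal squares and equal products along all relations
are translates of one another. -/
lemma exists_translate_of_prod_ft_eq (φ ψ : (Fin n → ZMod 2) → ℕ)
    (hsq : ∀ u, ft φ u ^ 2 = ft ψ u ^ 2)
    (h : ∀ C : Finset (Fin n → ZMod 2), ∑ u ∈ C, u = 0 → ∏ u ∈ C, ft φ u = ∏ u ∈ C, ft ψ u) :
    ∃ z, ∀ x, ψ x = φ (z + x) := by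
  let e : (Fin n → ZMod 2) → ZMod 2 := fun u => if ft ψ u = ft φ u then 0 else 1
  have he : ∀ u, ft ψ u = sgn (e u) * ft φ u := fun u => by
    by_cases hu : ft ψ u = ft φ u
    · simp [e, sgn, hu]
    · rcases sq_eq_sq_iff_eq_or_eq_neg.mp (hsq u).symm with h1 | h1
      · exact absurd h1 hu
      · rw [h1, show e u = 1 from if_neg hu]; simp [sgn]
  have hsgn : ∀ C : Finset (Fin n → ZMod 2), sgn (∑ u ∈ C, e u) = ∏ u ∈ C, sgn (e u) := fun C => by
    induction C using Finset.induction_on with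
    | empty => simp [sgn]
    | insert a s ha ih => rw [sum_insert ha, prod_insert ha, sgn_add, ih]
  obtain ⟨z, hz⟩ := exists_chi_eq (univ.filter fun u => ft φ u ≠ 0) e fun C hC h0 => by
    have h1 := h C h0
    rw [prod_congr rfl fun u _ => he u, prod_mul_distrib, ← hsgn] at h1
    have hne : ∏ u ∈ C, ft φ u ≠ 0 := prod_ne_zero_iff.mpr fun u hu => (mem_filter.mp (hC hu)).2
    have h2 : sgn (∑ u ∈ C, e u) = 1 := (mul_eq_right₀ hne).mp h1.symm
    by_contra h3
    simp [sgn, h3] at h2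
  refine ⟨z, fun x => ?_⟩
  have hft : ∀ u, ft ψ u = chi u z * ft φ u := fun u => by
    by_cases hu : ft φ u = 0
    · rw [he, hu, mul_zero, mul_zero]
    · rw [he, chi, hz u (by simpa using hu)]
  have h1 := ft_inversion φ (z + x)
  have h2 : ∑ u, ft φ u * chi u (z + x) = ∑ u, ft ψ u * chi u x :=
    sum_congr rfl fun u _ => by rw [hft, chi_add_right]; ring
  rw [h2, ft_inversion] at h1
  exact_mod_cast mul_left_cancel₀ (by positivity) h1

lemma Indist.exists_translate_or_bound {m : ℕ} (hm : 2 ≤ m) (φ ψ : (Fin n → ZMod 2) → ℕ)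
    (hφ : ∀ x, φ x ≤ 1) (hψ : ∀ x, ψ x ≤ 1) (h : Indist m φ ψ) :
    (∃ z, ∀ x, ψ x = φ (z + x)) ∨ ∃ r, m < r ∧ r * 2 ^ r ≤ 2 ^ (n + 1) := by
  have hsq := h.ft_sq_eq hm
  by_cases hall : ∀ C : Finset (Fin n → ZMod 2), ∑ u ∈ C, u = 0 →
      ∏ u ∈ C, ft φ u = ∏ u ∈ C, ft ψ u
  · exact Or.inl (exists_translate_of_prod_ft_eq φ ψ hsq hall)
  right
  push Not at hall
  obtain ⟨C, hCmem, hmin⟩ := exists_min_image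
    (univ.filter fun C : Finset (Fin n → ZMod 2) =>
      ∑ u ∈ C, u = 0 ∧ ∏ u ∈ C, ft φ u ≠ ∏ u ∈ C, ft ψ u) card
    (by obtain ⟨C, h1, h2⟩ := hall; exact ⟨C, by simp [h1, h2]⟩)
  obtain ⟨hsum, hne⟩ := (mem_filter.mp hCmem).2
  have hsmall : ∀ A : Finset (Fin n → ZMod 2), #A < #C → ∑ u ∈ A, u = 0 →
      ∏ u ∈ A, ft φ u = ∏ u ∈ A, ft ψ u := fun A hA h0 => by
    by_contra h1
    exact absurd (hmin A (by simp [h0, h1])) (not_le.mpr hA)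
  have hmC : m < #C := by
    by_contra h1
    exact hne (h.prod_finset_ft_eq C (not_lt.mp h1) hsum)
  have hsplit (A) (hA : A ⊆ C) : ∑ u ∈ C \ A, u = ∑ u ∈ A, u := by
    rw [← add_eq_zero_iff_vec, sum_sdiff hA, hsum]
  have hcardsd (A) (hA : A ⊆ C) : #(C \ A) + #A = #C := card_sdiff_add_card_eq_card hA
  have hcirc : ∀ A ⊆ C, A.Nonempty → #A < #C → ∑ u ∈ A, u ≠ 0 := fun A hA hA0 hlt h0 => by
    have hpos := hA0.card_pos
    have hcard := hcardsd A hA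
    refine hne ?_
    rw [← prod_sdiff hA, ← prod_sdiff hA, hsmall A hlt h0,
      hsmall (C \ A) (by omega) ((hsplit A hA).trans h0)]
  have hnotmem : ∀ A ⊆ C, 2 ≤ #A → #A < #C → ∑ u ∈ A, u ∉ A := fun A hA h2 hlt hmem => by
    have hcard := card_erase_of_mem hmem
    refine hcirc (A.erase (∑ u ∈ A, u)) ((erase_subset _ _).trans hA)
      (card_pos.mp (by omega)) (by omega) ?_
    have := sum_erase_add A (fun u => u) hmem
    simpa using this
  have hmid : ∀ A ⊆ C, 2 ≤ #A → #A + 2 ≤ #C → ft φ (∑ u ∈ A, u) = 0 := fun A hA h2 hr => by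
    have hrel : ∀ B ⊆ C, 2 ≤ #B → #B + 2 ≤ #C →
        ft φ (∑ u ∈ B, u) * ∏ u ∈ B, ft φ u = ft ψ (∑ u ∈ B, u) * ∏ u ∈ B, ft ψ u :=
      fun B hB h2 hr => by
        have hn := hnotmem B hB h2 (by omega)
        rw [← prod_insert hn, ← prod_insert hn]
        refine hsmall _ (by rw [card_insert_of_notMem hn]; omega) ?_
        rw [sum_insert hn, add_self_eq_zero_vec]
    have hcard := hcardsd A hA
    have h1 := hrel A hA h2 hr
    have h3 := hrel (C \ A) sdiff_subset (by omega) (by omega)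
    rw [hsplit A hA] at h3
    by_contra h0
    refine hne ?_
    rw [← prod_sdiff hA, ← prod_sdiff hA]
    refine mul_left_cancel₀ (pow_ne_zero 2 h0) ?_
    calc _ = (ft φ (∑ u ∈ A, u) * ∏ u ∈ C \ A, ft φ u) *
          (ft φ (∑ u ∈ A, u) * ∏ u ∈ A, ft φ u) := by ring
      _ = ft ψ (∑ u ∈ A, u) ^ 2 * ((∏ u ∈ C \ A, ft ψ u) * ∏ u ∈ A, ft ψ u) := by
        rw [h1, h3]; ring
      _ = _ := by rw [hsq]
  have hmid' : ∀ A ⊆ C, 2 ≤ #A → #A + 2 ≤ #C → ft ψ (∑ u ∈ A, u) = 0 := fun A hA h2 hr => by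
    have := hsq (∑ u ∈ A, u)
    rw [hmid A hA h2 hr] at this
    simpa using this.symm
  have hnz : ∀ u ∈ C, ft φ u ≠ 0 := fun u hu h0 => by
    have h1 := hsq u
    rw [h0] at h1
    have h2 : ft ψ u = 0 := by simpa using h1.symm
    exact hne (by rw [prod_eq_zero hu h0, prod_eq_zero hu h2])
  have hzero : ft φ 0 = ft ψ 0 := by
    simpa using h.prod_finset_ft_eq {0} (by simp; omega) (by simp)
  let ε : (Fin n → ZMod 2) → ℤ := fun u => if ft ψ u = ft φ u then 1 else -1
  have hε : ∀ u, ε u = 1 ∨ ε u = -1 := fun u => by simp only [ε]; split_ifs <;> simp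
  have hψε : ∀ u, ft ψ u = ε u * ft φ u := fun u => by
    by_cases hu : ft ψ u = ft φ u
    · simp [ε, hu]
    · rcases sq_eq_sq_iff_eq_or_eq_neg.mp (hsq u).symm with h1 | h1
      · exact absurd h1 hu
      · rw [h1, show ε u = -1 from if_neg hu, neg_one_mul]
  have hprod_or (η : (Fin n → ZMod 2) → ℤ) (hη : ∀ u, η u = 1 ∨ η u = -1) :
      ∏ u ∈ C, η u = 1 ∨ ∏ u ∈ C, η u = -1 :=
    prod_induction _ (fun a => a = 1 ∨ a = -1)
      (by rintro a b (rfl | rfl) (rfl | rfl) <;> simp) (Or.inl rfl) fun u _ => hη u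
  have hεprod : ∏ u ∈ C, ε u = -1 := (hprod_or ε hε).resolve_left fun h1 => hne <| by
    rw [prod_congr rfl fun u _ => hψε u, prod_mul_distrib, h1, one_mul]
  refine ⟨#C, hmC, ?_⟩
  have hfin := card_mul_two_pow_le C (ft φ 0) (2 ^ n) (ft φ) hnz fun η hη => by
    rcases hprod_or η hη with h1 | h1
    · exact riesz_dvd_and_bounds φ hφ C (by omega) hsum hcirc hmid η hη h1
    · have := riesz_dvd_and_bounds ψ hψ C (by omega) hsum hcirc hmid' (fun u => ε u * η u)
        (fun u => by rcases hη u with h2 | h2 <;> rcases hε u with h3 | h3 <;> simp [h2, h3])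
        (by rw [prod_mul_distrib, h1, hεprod]; norm_num)
      have he : ∑ u ∈ C, ft ψ u * (ε u * η u) = ∑ u ∈ C, ft φ u * η u :=
        sum_congr rfl fun u _ => by
          rw [hψε]
          rcases hε u with h3 | h3 <;> rw [h3] <;> ring
      rwa [he, ← hzero] at this
  rw [pow_succ']
  exact_mod_cast hfin

end Reconstruction

lemma Indist.card_eq {G : Type*} [Fintype G] [AddCommGroup G] [DecidableEq G] {m : ℕ}
    {S T : Finset G} (h : Indist m (indic S) (indic T)) (hm : 1 ≤ m) : #S = #T := by
  have := congrFun (h 1 hm) 0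
  simpa [deck, indic] using this

lemma exists_translate_of_card_eq : ∀ S T : Finset (Fin 1 → ZMod 2), #S = #T →
    ∃ z : Fin 1 → ZMod 2, T = S.image fun x => z + x := by
  decide


/-- For positive integers `n` and `k`, if the reconstruction number of `𝔽₂^n` is at
least `k` — i.e. there are subsets `S₁, S₂ ⊆ 𝔽₂^n` which are `(k-1)`-indistinguishable
but not translates of one another — then `2^(n+1−k) ≥ k` (as a real inequality,
allowing negative exponent). -/
theorem stmt15 (n k : ℕ) (hn : 0 < n) (hk : 0 < k)
    (S₁ S₂ : Finset (Fin n → ZMod 2))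
    (hindist : Indist (k - 1) (indic S₁) (indic S₂))
    (hnottrans : ¬ ∃ z : Fin n → ZMod 2, S₂ = S₁.image (fun x => z + x)) :
    (k : ℝ) ≤ (2 : ℝ) ^ ((n : ℝ) + 1 - (k : ℝ)) := by
  suffices h : k * 2 ^ k ≤ 2 ^ (n + 1) by
    have h' : (k : ℝ) * 2 ^ k ≤ 2 ^ (n + 1) := by exact_mod_cast h
    rw [Real.rpow_sub two_pos, Real.rpow_natCast, le_div_iff₀ (by positivity)]
    exact_mod_cast h'
  have hpow {a b : ℕ} (hab : a ≤ b) : 2 ^ a ≤ 2 ^ b := Nat.pow_le_pow_right two_pos hab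
  obtain rfl | rfl | hk3 : k = 1 ∨ k = 2 ∨ 3 ≤ k := by omega
  · simpa using hpow (show 1 ≤ n + 1 by omega)
  · obtain rfl | hn2 : n = 1 ∨ 2 ≤ n := by omega
    · exact absurd (exists_translate_of_card_eq S₁ S₂ (hindist.card_eq le_rfl)) hnottrans
    · simpa using hpow (show 3 ≤ n + 1 by omega)
  · have hle (S : Finset (Fin n → ZMod 2)) (x : Fin n → ZMod 2) : indic S x ≤ 1 := by
      unfold indic; split_ifs <;> simp
    rcases Indist.exists_translate_or_bound (by omega) _ _ (hle S₁) (hle S₂) hindist with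
      ⟨z, hz⟩ | ⟨r, hr, hbound⟩
    · refine absurd ⟨z, ?_⟩ hnottrans
      have hmem : ∀ x, x ∈ S₂ ↔ z + x ∈ S₁ := fun x => by
        have := hz x
        unfold indic at this
        split_ifs at this <;> simp_all
      ext x
      rw [hmem, mem_image]
      constructor
      · exact fun hx => ⟨z + x, hx, by rw [← add_assoc, add_self_eq_zero_vec, zero_add]⟩
      · rintro ⟨y, hy, rfl⟩
        rwa [← add_assoc, add_self_eq_zero_vec, zero_add]
    · have hkr : k ≤ r := by omega
      exact (Nat.mul_le_mul hkr (hpow hkr)).trans hbound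
end
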